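/- arXiv:1701.09148 — 2 statements merged into one kernel-verified Lean document; each statement's English description precedes it below -/
import Mathlib

section
/- Fix an integer k ≥ 2 and let n = kr with r → ∞; let λ = k − 1 and α = n^{2/3}/log³ n. Let a = a(n) be a sequence of positive reals with a^{−1}·log^{−1/3} n = o(1), and set ξ = (E_n^{{0,k}}(T))^a. Then for all sufficiently large r, every {0,k}-mapping f on [n] with Z(f) ≤ α satisfies T(f) < ξ. -/
open Filter Finset Asymptotics MeasureTheory

noncomputable section

open scoped Classical

/-- `f` is a `{0,k}`-mapping: every point has either `0` or `k` preimages. -/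
def IsZKMap {n : ℕ} (k : ℕ) (f : Fin n → Fin n) : Prop :=
  ∀ y : Fin n,
    (Finset.univ.filter fun x => f x = y).card = 0 ∨
    (Finset.univ.filter fun x => f x = y).card = k

/-- The finite set of `{0,k}`-mappings on `[n]`. -/
def zkMaps (n k : ℕ) : Finset (Fin n → Fin n) :=
  Finset.univ.filter fun f => IsZKMap k f

/-- The set of cyclic nodes of `f`. -/
def cyclicSet {n : ℕ} (f : Fin n → Fin n) : Finset (Fin n) :=
  Finset.univ.filter fun x => ∃ m, 0 < m ∧ f^[m] x = x

/-- `Z f`: the number of cyclic nodes of `f`. -/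
def Zmap {n : ℕ} (f : Fin n → Fin n) : ℕ := (cyclicSet f).card

/-- The cycles of `f`: the orbits of the cyclic nodes under `f`. -/
def cyclesOf {n : ℕ} (f : Fin n → Fin n) : Finset (Finset (Fin n)) :=
  (cyclicSet f).image fun x => (cyclicSet f).filter fun y => ∃ m, f^[m] x = y

/-- `T f`: the least common multiple of the cycle lengths of `f`. -/
def Tmap {n : ℕ} (f : Fin n → Fin n) : ℕ := (cyclesOf f).lcm Finset.card

/-- `B f`: the product of the cycle lengths of `f`, counted with multiplicity. -/
def Bmap {n : ℕ} (f : Fin n → Fin n) : ℕ := ∏ c ∈ cyclesOf f, c.card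

/-- `C f`: the number of cycles of `f`. -/
def Cmap {n : ℕ} (f : Fin n → Fin n) : ℕ := (cyclesOf f).card

/-- Uniform probability of the event `p` over `{0,k}`-mappings on `[n]`. -/
def zkProb (n k : ℕ) (p : (Fin n → Fin n) → Prop) : ℝ :=
  (((zkMaps n k).filter p).card : ℝ) / ((zkMaps n k).card : ℝ)

/-- Expectation of `X` under the uniform measure on `{0,k}`-mappings on `[n]`. -/
def zkExp (n k : ℕ) (X : (Fin n → Fin n) → ℝ) : ℝ :=
  (∑ f ∈ zkMaps n k, X f) / ((zkMaps n k).card : ℝ)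

/-- The standard normal cumulative distribution function. -/
def stdNormalCDF (x : ℝ) : ℝ :=
  (Real.sqrt (2 * Real.pi))⁻¹ * ∫ t in Set.Iic x, Real.exp (-t ^ 2 / 2)

/-- `M m`: the average order of a uniformly random permutation of `[m]`. -/
def Mperm (m : ℕ) : ℝ :=
  (∑ σ : Equiv.Perm (Fin m), (orderOf σ : ℝ)) / (m.factorial : ℝ)

lemma mem_cyclicSet {n : ℕ} {f : Fin n → Fin n} {x : Fin n} :
    x ∈ cyclicSet f ↔ x ∈ Function.periodicPts f := by
  simp [cyclicSet, Function.mem_periodicPts, Function.IsPeriodicPt, Function.IsFixedPt]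

lemma iterate_mem_cyclicSet {n : ℕ} {f : Fin n → Fin n} {x : Fin n} (hx : x ∈ cyclicSet f)
    (j : ℕ) : f^[j] x ∈ cyclicSet f := by
  rw [mem_cyclicSet, Function.mem_periodicPts] at *
  obtain ⟨m, hm, h⟩ := hx
  exact ⟨m, hm, h.apply_iterate j⟩

lemma card_orbit_eq_minimalPeriod {n : ℕ} {f : Fin n → Fin n} {x : Fin n}
    (hx : x ∈ cyclicSet f) :
    ((cyclicSet f).filter fun y => ∃ m, f^[m] x = y).card = Function.minimalPeriod f x := by
  have : ((cyclicSet f).filter fun y => ∃ m, f^[m] x = y) =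
      (Finset.range (Function.minimalPeriod f x)).image (fun j => f^[j] x) := by
    ext y
    simp only [Finset.mem_filter, Finset.mem_image, Finset.mem_range]
    constructor
    · rintro ⟨-, m, rfl⟩
      exact ⟨m % Function.minimalPeriod f x,
        Nat.mod_lt _ (Function.minimalPeriod_pos_of_mem_periodicPts (mem_cyclicSet.1 hx)),
        Function.iterate_mod_minimalPeriod_eq⟩
    · rintro ⟨j, -, rfl⟩
      exact ⟨iterate_mem_cyclicSet hx j, j, rfl⟩
  rw [this, Finset.card_image_of_injOn, Finset.card_range]
  simpa using Function.iterate_injOn_Iio_minimalPeriod (f := f) (x := x)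

lemma card_pos_of_mem_cyclesOf {n : ℕ} {f : Fin n → Fin n} {c : Finset (Fin n)}
    (hc : c ∈ cyclesOf f) : 0 < c.card := by
  obtain ⟨x, hx, rfl⟩ := Finset.mem_image.1 hc
  exact Finset.card_pos.2 ⟨x, Finset.mem_filter.2 ⟨hx, 0, rfl⟩⟩

lemma Tmap_ne_zero {n : ℕ} (f : Fin n → Fin n) : Tmap f ≠ 0 := by
  rw [Tmap, Ne, Finset.lcm_eq_zero_iff]
  rintro ⟨c, hc, h⟩
  exact (card_pos_of_mem_cyclesOf hc).ne' h

lemma iterate_Tmap {n : ℕ} {f : Fin n → Fin n} {x : Fin n} (hx : x ∈ cyclicSet f) :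
    f^[Tmap f] x = x := by
  have h : Function.minimalPeriod f x ∣ Tmap f := by
    rw [← card_orbit_eq_minimalPeriod hx]
    exact Finset.dvd_lcm (Finset.mem_image_of_mem _ hx)
  exact Function.isPeriodicPt_iff_minimalPeriod_dvd.2 h

lemma sum_card_cyclesOf_le {n : ℕ} (f : Fin n → Fin n) :
    ∑ c ∈ cyclesOf f, c.card ≤ Zmap f := by
  have hsymm : ∀ x ∈ cyclicSet f, ∀ m, ∃ j, f^[j] (f^[m] x) = x := by
    intro x hx m
    rw [mem_cyclicSet, Function.mem_periodicPts] at hx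
    obtain ⟨p, hp, h⟩ := hx
    refine ⟨p * m - m, ?_⟩
    rw [← Function.iterate_add_apply, Nat.sub_add_cancel (Nat.le_mul_of_pos_left m hp)]
    exact (h.mul_const m)
  rw [← Finset.card_biUnion]
  · refine Finset.card_le_card (Finset.biUnion_subset.2 fun c hc => ?_)
    obtain ⟨x, hx, rfl⟩ := Finset.mem_image.1 hc
    exact Finset.filter_subset _ _
  · intro c hc d hd hcd
    obtain ⟨x, hx, rfl⟩ := Finset.mem_image.1 hc
    obtain ⟨y, hy, rfl⟩ := Finset.mem_image.1 hd
    refine Finset.disjoint_left.2 fun z hzx hzy => hcd ?_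
    obtain ⟨-, i, rfl⟩ := Finset.mem_filter.1 hzx
    obtain ⟨-, j, hj⟩ := Finset.mem_filter.1 hzy
    obtain ⟨i', hi'⟩ := hsymm x hx i
    obtain ⟨j', hj'⟩ := hsymm y hy j
    ext w
    simp only [Finset.mem_filter, and_congr_right_iff]
    intro _
    constructor
    · rintro ⟨l, rfl⟩
      exact ⟨l + i' + j, by rw [Function.iterate_add_apply, hj, Function.iterate_add_apply, hi']⟩
    · rintro ⟨l, rfl⟩
      refine ⟨l + j' + i, ?_⟩
      rw [Function.iterate_add_apply, ← hj, Function.iterate_add_apply, hj']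

lemma injOn_cyclicSet {n : ℕ} (f : Fin n → Fin n) : Set.InjOn f (cyclicSet f) := by
  intro x hx y hy h
  have hx' := mem_cyclicSet.1 (Finset.mem_coe.1 hx)
  have hy' := mem_cyclicSet.1 (Finset.mem_coe.1 hy)
  rw [Function.mem_periodicPts] at hx' hy'
  obtain ⟨p, hp, hxp⟩ := hx'
  obtain ⟨q, hq, hyq⟩ := hy'
  exact hxp.eq_of_apply_eq hyq hp hq h

/-- The permutation induced by `f` on its cyclic nodes. -/
def cyclicPerm {n : ℕ} (f : Fin n → Fin n) (A : Finset (Fin n)) (h : cyclicSet f = A) :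
    Equiv.Perm A :=
  Equiv.ofBijective (fun x => ⟨f x, by subst h; exact iterate_mem_cyclicSet x.2 1⟩)
    (Finite.injective_iff_bijective.1 fun x y hxy =>
      Subtype.ext (injOn_cyclicSet f (by rw [h]; exact x.2) (by rw [h]; exact y.2)
        (congrArg Subtype.val hxy)))

lemma iterate_comp_ofSubtype {n : ℕ} {f : Fin n → Fin n} {A : Finset (Fin n)}
    (h : cyclicSet f = A) (σ : Equiv.Perm A) (j : ℕ) (x : A) :
    (f ∘ Equiv.Perm.ofSubtype σ)^[j] (x : Fin n) = ((cyclicPerm f A h * σ) ^ j) x := by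
  induction j with
  | zero => simp
  | succ j ih =>
    rw [Function.iterate_succ_apply', ih, pow_succ', Equiv.Perm.mul_apply]
    simp [cyclicPerm]

lemma cyclicSet_comp_ofSubtype {n : ℕ} {f : Fin n → Fin n} {A : Finset (Fin n)}
    (h : cyclicSet f = A) (σ : Equiv.Perm A) :
    cyclicSet (f ∘ Equiv.Perm.ofSubtype σ) = A := by
  have key : ∀ x ∈ A, ∀ j, (f ∘ Equiv.Perm.ofSubtype σ)^[j] x ∈ A := by
    intro x hx j
    have := iterate_comp_ofSubtype h σ j ⟨x, hx⟩
    simp only at this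
    rw [this]
    exact Subtype.prop _
  ext x
  constructor
  · intro hx
    by_contra hxA
    rw [cyclicSet, Finset.mem_filter] at hx
    obtain ⟨-, m, hm, hx⟩ := hx
    have hout : ∀ j ≤ m, (f ∘ Equiv.Perm.ofSubtype σ)^[j] x ∉ A := by
      intro j hj hmem
      have := key _ hmem (m - j)
      rw [← Function.iterate_add_apply, Nat.sub_add_cancel hj, hx] at this
      exact hxA this
    have heq : ∀ j ≤ m, (f ∘ Equiv.Perm.ofSubtype σ)^[j] x = f^[j] x := by
      intro j
      induction j with
      | zero => simp
      | succ j ih =>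
        intro hj
        rw [Function.iterate_succ_apply', Function.iterate_succ_apply', ← ih (by omega)]
        rw [Function.comp_apply, Equiv.Perm.ofSubtype_apply_of_not_mem _ (hout j (by omega))]
    apply hxA
    rw [← h, cyclicSet, Finset.mem_filter]
    exact ⟨Finset.mem_univ _, m, hm, by rw [← heq m le_rfl, hx]⟩
  · intro hx
    rw [cyclicSet, Finset.mem_filter]
    refine ⟨Finset.mem_univ _, orderOf (cyclicPerm f A h * σ), orderOf_pos _, ?_⟩
    have := iterate_comp_ofSubtype h σ (orderOf (cyclicPerm f A h * σ)) ⟨x, hx⟩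
    simpa [pow_orderOf_eq_one] using this

lemma orderOf_le_Tmap_comp {n : ℕ} {f : Fin n → Fin n} {A : Finset (Fin n)}
    (h : cyclicSet f = A) (σ : Equiv.Perm A) :
    orderOf (cyclicPerm f A h * σ) ≤ Tmap (f ∘ Equiv.Perm.ofSubtype σ) := by
  refine Nat.le_of_dvd (Nat.pos_of_ne_zero (Tmap_ne_zero _)) (orderOf_dvd_of_pow_eq_one ?_)
  ext x : 2
  rw [← iterate_comp_ofSubtype h, iterate_Tmap]
  · rfl
  · rw [cyclicSet_comp_ofSubtype h]
    exact x.2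

lemma comp_perm_mem_zkMaps {n k : ℕ} {f : Fin n → Fin n} (hf : f ∈ zkMaps n k)
    (e : Equiv.Perm (Fin n)) : f ∘ e ∈ zkMaps n k := by
  rw [zkMaps, Finset.mem_filter] at *
  refine ⟨Finset.mem_univ _, fun y => ?_⟩
  have : (Finset.univ.filter fun x => (f ∘ e) x = y).card =
      (Finset.univ.filter fun x => f x = y).card :=
    Finset.card_equiv e (by simp)
  rw [this]
  exact hf.2 y

lemma le_sum_Tmap_of_cyclicSet_eq {n k : ℕ} (A : Finset (Fin n)) (L : ℝ)
    (hL : (A.card.factorial : ℝ) * L ≤ ∑ τ : Equiv.Perm A, (orderOf τ : ℝ)) :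
    (((zkMaps n k).filter fun f => cyclicSet f = A).card : ℝ) * L ≤
      ∑ f ∈ (zkMaps n k).filter fun f => cyclicSet f = A, (Tmap f : ℝ) := by
  set F := (zkMaps n k).filter fun f => cyclicSet f = A with hF
  have hcomp : ∀ σ : Equiv.Perm A, ∀ f ∈ F, f ∘ Equiv.Perm.ofSubtype σ ∈ F := by
    intro σ f hf
    rw [hF, Finset.mem_filter] at *
    exact ⟨comp_perm_mem_zkMaps hf.1 _, cyclicSet_comp_ofSubtype hf.2 σ⟩
  have hinv : ∀ σ : Equiv.Perm A, ∑ f ∈ F, (Tmap (f ∘ Equiv.Perm.ofSubtype σ) : ℝ) =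
      ∑ f ∈ F, (Tmap f : ℝ) := by
    intro σ
    refine Finset.sum_nbij' (fun f => f ∘ Equiv.Perm.ofSubtype σ)
      (fun f => f ∘ Equiv.Perm.ofSubtype σ⁻¹) (hcomp σ) (hcomp σ⁻¹) ?_ ?_ (fun _ _ => rfl)
    · intro f _
      ext x
      simp
    · intro f _
      ext x
      simp
  have hfac : (0 : ℝ) < A.card.factorial := by exact_mod_cast Nat.factorial_pos _
  have hcard : (Fintype.card (Equiv.Perm A) : ℝ) = A.card.factorial := by
    rw [Fintype.card_perm, Fintype.card_coe]
  refine le_of_mul_le_mul_left ?_ hfac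
  calc (A.card.factorial : ℝ) * (F.card * L) = ∑ f ∈ F, (A.card.factorial : ℝ) * L := by
        rw [Finset.sum_const, nsmul_eq_mul]; ring
    _ ≤ ∑ f ∈ F, ∑ σ : Equiv.Perm A, (Tmap (f ∘ Equiv.Perm.ofSubtype σ) : ℝ) := by
        refine Finset.sum_le_sum fun f hf => hL.trans ?_
        have h := (Finset.mem_filter.1 hf).2
        rw [← Equiv.sum_comp (Equiv.mulLeft (cyclicPerm f A h))]
        exact Finset.sum_le_sum fun σ _ => by
          exact_mod_cast orderOf_le_Tmap_comp h σ
    _ = ∑ σ : Equiv.Perm A, ∑ f ∈ F, (Tmap (f ∘ Equiv.Perm.ofSubtype σ) : ℝ) :=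
        Finset.sum_comm
    _ = (A.card.factorial : ℝ) * ∑ f ∈ F, (Tmap f : ℝ) := by
        simp_rw [hinv]
        rw [Finset.sum_const, nsmul_eq_mul, Finset.card_univ, hcard]

lemma le_sum_Tmap {n k m : ℕ} {L : ℝ}
    (hL : ∀ A : Finset (Fin n), m ≤ A.card →
      (A.card.factorial : ℝ) * L ≤ ∑ τ : Equiv.Perm A, (orderOf τ : ℝ)) :
    (((zkMaps n k).filter fun f => m ≤ Zmap f).card : ℝ) * L ≤
      ∑ f ∈ zkMaps n k, (Tmap f : ℝ) := by
  set G := (zkMaps n k).filter fun f => m ≤ Zmap f with hG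
  have hfib : ∀ A : Finset (Fin n), m ≤ A.card → (G.filter fun f => cyclicSet f = A) =
      (zkMaps n k).filter fun f => cyclicSet f = A := by
    intro A hA
    ext f
    rw [Finset.mem_filter, hG, Finset.mem_filter, Finset.mem_filter, Zmap]
    constructor
    · rintro ⟨⟨h1, -⟩, h2⟩
      exact ⟨h1, h2⟩
    · rintro ⟨h1, rfl⟩
      exact ⟨⟨h1, hA⟩, rfl⟩
  have hmaps : ∀ f ∈ G, cyclicSet f ∈ Finset.univ.filter fun A : Finset (Fin n) => m ≤ A.card :=
    fun f hf => Finset.mem_filter.2 ⟨Finset.mem_univ _, (Finset.mem_filter.1 hf).2⟩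
  calc (G.card : ℝ) * L ≤ ∑ f ∈ G, (Tmap f : ℝ) := by
        rw [← Finset.sum_fiberwise_of_maps_to hmaps, Finset.card_eq_sum_card_fiberwise hmaps]
        push_cast
        rw [Finset.sum_mul]
        refine Finset.sum_le_sum fun A hA => ?_
        have hA' := (Finset.mem_filter.1 hA).2
        rw [hfib A hA']
        exact le_sum_Tmap_of_cyclicSet_eq A L (hL A hA')
    _ ≤ _ := Finset.sum_le_sum_of_subset_of_nonneg (Finset.filter_subset _ _)
        fun _ _ _ => Nat.cast_nonneg _

lemma sum_le_prod_of_two_le {ι : Type*} (s : Finset ι) (g : ι → ℕ) (hg : ∀ i ∈ s, 2 ≤ g i)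
    (hs : s.Nonempty) : ∑ i ∈ s, g i ≤ ∏ i ∈ s, g i := by
  induction hs using Finset.Nonempty.cons_induction with
  | singleton a => simp
  | cons a s ha hs ih =>
    have h1 := ih fun i hi => hg i (Finset.mem_cons_of_mem hi)
    have h2 := hg a (Finset.mem_cons_self _ _)
    obtain ⟨b, hb⟩ := hs
    have h3 : 2 ≤ ∑ i ∈ s, g i := (hg b (Finset.mem_cons_of_mem hb)).trans
      (Finset.single_le_sum (f := g) (fun _ _ => Nat.zero_le _) hb)
    rw [Finset.sum_cons, Finset.prod_cons]
    nlinarith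

lemma sum_primeFactors_le {c : ℕ} (hc : c ≠ 0) : ∑ p ∈ c.primeFactors, p ≤ c := by
  rcases c.primeFactors.eq_empty_or_nonempty with h | h
  · simp [h]
  · exact (sum_le_prod_of_two_le _ _ (fun p hp => (Nat.prime_of_mem_primeFactors hp).two_le) h).trans
      (Nat.le_of_dvd (Nat.pos_of_ne_zero hc) (Nat.prod_primeFactors_dvd c))

lemma pow_dvd_or_pow_dvd_of_dvd_lcm {p v a b : ℕ} (hp : p.Prime) (h : p ^ v ∣ Nat.lcm a b) :
    p ^ v ∣ a ∨ p ^ v ∣ b := by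
  rcases eq_or_ne a 0 with rfl | ha
  · simp
  rcases eq_or_ne b 0 with rfl | hb
  · simp
  rw [hp.pow_dvd_iff_le_factorization (Nat.lcm_ne_zero ha hb), Nat.factorization_lcm ha hb,
    Finsupp.sup_apply, le_sup_iff] at h
  rwa [hp.pow_dvd_iff_le_factorization ha, hp.pow_dvd_iff_le_factorization hb]

lemma sum_biUnion_le_sum {ι : Type*} (s : Finset ι) (t : ι → Finset ℕ) (g : ℕ → ℕ) :
    ∑ p ∈ s.biUnion t, g p ≤ ∑ i ∈ s, ∑ p ∈ t i, g p := by
  induction s using Finset.induction_on with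
  | empty => simp
  | insert a s ha ih =>
    rw [Finset.biUnion_insert, Finset.sum_insert ha]
    have := Finset.sum_union_inter (s₁ := t a) (s₂ := s.biUnion t) (f := g)
    omega

lemma exists_dvd_of_prime_pow_dvd_lcm {ι : Type*} {s : Finset ι} {g : ι → ℕ} {p v : ℕ}
    (hp : p.Prime) (hv : v ≠ 0) (h : p ^ v ∣ s.lcm g) : ∃ i ∈ s, p ^ v ∣ g i := by
  induction s using Finset.induction_on with
  | empty =>
    rw [Finset.lcm_empty] at h
    exact absurd (Nat.dvd_one.1 h) (Nat.one_lt_pow hv hp.one_lt).ne'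
  | insert a s ha ih =>
    rw [Finset.lcm_insert] at h
    rcases pow_dvd_or_pow_dvd_of_dvd_lcm hp h with h | h
    · exact ⟨a, Finset.mem_insert_self _ _, h⟩
    · obtain ⟨i, hi, h⟩ := ih h
      exact ⟨i, Finset.mem_insert_of_mem hi, h⟩

lemma sum_primeFactors_Tmap_le {n : ℕ} (f : Fin n → Fin n) :
    ∑ p ∈ (Tmap f).primeFactors, p ≤ Zmap f := by
  refine le_trans ?_ (sum_card_cyclesOf_le f)
  have hsub : (Tmap f).primeFactors ⊆ (cyclesOf f).biUnion fun c => c.card.primeFactors := by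
    intro p hp
    have hpp := Nat.prime_of_mem_primeFactors hp
    obtain ⟨c, hc, h⟩ := exists_dvd_of_prime_pow_dvd_lcm hpp one_ne_zero
      (s := cyclesOf f) (g := Finset.card) (by rw [pow_one]; exact Nat.dvd_of_mem_primeFactors hp)
    exact Finset.mem_biUnion.2 ⟨c, hc, Nat.mem_primeFactors.2
      ⟨hpp, by simpa using h, (card_pos_of_mem_cyclesOf hc).ne'⟩⟩
  calc ∑ p ∈ (Tmap f).primeFactors, p
      ≤ ∑ p ∈ (cyclesOf f).biUnion fun c => c.card.primeFactors, p :=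
        Finset.sum_le_sum_of_subset hsub
    _ ≤ ∑ c ∈ cyclesOf f, ∑ p ∈ c.card.primeFactors, p := sum_biUnion_le_sum _ _ _
    _ ≤ ∑ c ∈ cyclesOf f, c.card :=
        Finset.sum_le_sum fun c hc => sum_primeFactors_le (card_pos_of_mem_cyclesOf hc).ne'

lemma Tmap_le_pow {n : ℕ} (f : Fin n → Fin n) : Tmap f ≤ n ^ (Tmap f).primeFactors.card := by
  have h := Nat.prod_factorization_pow_eq_self (Tmap_ne_zero f)
  rw [Finsupp.prod, Nat.support_factorization] at h
  conv_lhs => rw [← h]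
  refine Finset.prod_le_pow_card _ _ _ fun p hp => ?_
  have hpp := Nat.prime_of_mem_primeFactors hp
  have hv : (Tmap f).factorization p ≠ 0 :=
    (hpp.factorization_pos_of_dvd (Tmap_ne_zero f) (Nat.dvd_of_mem_primeFactors hp)).ne'
  obtain ⟨c, hc, h⟩ := exists_dvd_of_prime_pow_dvd_lcm hpp hv (s := cyclesOf f)
    (g := Finset.card) (Nat.ordProj_dvd _ _)
  exact (Nat.le_of_dvd (card_pos_of_mem_cyclesOf hc) h).trans
    ((Finset.card_le_univ c).trans (by simp))

lemma card_primeFactors_Tmap_le {n : ℕ} (f : Fin n → Fin n) {y : ℝ} (hy : 0 < y) :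
    ((Tmap f).primeFactors.card : ℝ) ≤ Nat.primeCounting ⌊y⌋₊ + Zmap f / y := by
  rw [← Finset.card_filter_add_card_filter_not (s := (Tmap f).primeFactors) (fun p => p ≤ ⌊y⌋₊)]
  push_cast
  refine add_le_add ?_ ?_
  · rw [Nat.primeCounting, Nat.primeCounting', Nat.count_eq_card_filter_range]
    norm_cast
    refine Finset.card_le_card fun p hp => ?_
    rw [Finset.mem_filter] at *
    exact ⟨Finset.mem_range.2 (by omega), Nat.prime_of_mem_primeFactors hp.1⟩
  · rw [le_div_iff₀ hy]
    calc _ = ∑ p ∈ (Tmap f).primeFactors.filter fun p => ¬ p ≤ ⌊y⌋₊, y := by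
          rw [Finset.sum_const, nsmul_eq_mul]
      _ ≤ ∑ p ∈ (Tmap f).primeFactors.filter fun p => ¬ p ≤ ⌊y⌋₊, (p : ℝ) := by
          refine Finset.sum_le_sum fun p hp => ?_
          exact ((Nat.floor_lt hy.le).1 (not_le.1 (Finset.mem_filter.1 hp).2)).le
      _ ≤ ∑ p ∈ (Tmap f).primeFactors, (p : ℝ) :=
          Finset.sum_le_sum_of_subset_of_nonneg (Finset.filter_subset _ _)
            fun _ _ _ => Nat.cast_nonneg _
      _ ≤ Zmap f := by
          rw [← Nat.cast_sum]
          exact_mod_cast sum_primeFactors_Tmap_le f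

lemma log_Tmap_le {n : ℕ} (hn : 1 ≤ n) (f : Fin n → Fin n) {y : ℝ} (hy : 0 < y) :
    Real.log (Tmap f) ≤ (Nat.primeCounting ⌊y⌋₊ + Zmap f / y) * Real.log n := by
  calc Real.log (Tmap f) ≤ Real.log ((n : ℝ) ^ (Tmap f).primeFactors.card) :=
        Real.log_le_log (by exact_mod_cast Nat.pos_of_ne_zero (Tmap_ne_zero f))
          (by exact_mod_cast Tmap_le_pow f)
    _ = (Tmap f).primeFactors.card * Real.log n := Real.log_pow _ _
    _ ≤ _ := mul_le_mul_of_nonneg_right (card_primeFactors_Tmap_le f hy)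
        (Real.log_nonneg (by exact_mod_cast hn))

lemma le_orderOf_of_cycleType {α : Type*} [Fintype α] [DecidableEq α] {g : Equiv.Perm α} {L : ℕ}
    {S : Finset ℕ} (hS : ∀ p ∈ S, p.Prime) (hg : g.cycleType = L ::ₘ S.val) :
    ∏ p ∈ S, p ≤ orderOf g := by
  refine Nat.le_of_dvd (orderOf_pos g) ?_
  refine Finset.prod_primes_dvd _ (fun p hp => (hS p hp).prime) fun p hp => ?_
  exact Equiv.Perm.dvd_of_mem_cycleType (by rw [hg]; exact Multiset.mem_cons_of_mem hp)

lemma card_le_card_cycleType_mul_prod {α : Type*} [Fintype α] [DecidableEq α] {y : ℕ} {S : Finset ℕ}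
    (hS : ∀ p ∈ S, p.Prime ∧ p ≤ y) (hy : (S.card + 1) * y + 2 ≤ Fintype.card α) :
    (Fintype.card α).factorial ≤ Fintype.card α *
      ((Finset.univ.filter fun g : Equiv.Perm α =>
        g.cycleType = (Fintype.card α - ∑ p ∈ S, p) ::ₘ S.val).card * ∏ p ∈ S, p) := by
  have hsum : ∑ p ∈ S, p ≤ S.card * y := by
    simpa using Finset.sum_le_card_nsmul S (fun p => p) y fun p hp => (hS p hp).2
  set L := Fintype.card α - ∑ p ∈ S, p with hL
  have hLy : y + 2 ≤ L := by
    have : (S.card + 1) * y = S.card * y + y := by ring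
    omega
  have hLS : L ∉ S := fun h => by have := (hS L h).2; omega
  have h := Equiv.Perm.card_of_cycleType_mul_eq α (L ::ₘ S.val)
  have hms : (L ::ₘ S.val).sum = Fintype.card α := by
    rw [Multiset.sum_cons, Finset.sum_val]
    simp only [id]
    omega
  have hnd : (L ::ₘ S.val).Nodup := Multiset.nodup_cons.2 ⟨hLS, S.nodup⟩
  rw [if_pos ⟨hms.le, by
    intro a ha
    rcases Multiset.mem_cons.1 ha with rfl | ha
    · omega
    · exact (hS a ha).1.two_le⟩, hms, Nat.sub_self, Nat.factorial_zero, one_mul,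
    Finset.prod_eq_one (fun a ha => by
      rw [Multiset.count_eq_one_of_mem hnd (Multiset.mem_toFinset.1 ha), Nat.factorial_one]),
    mul_one, Multiset.prod_cons, Finset.prod_val] at h
  rw [← h]
  simp only [id]
  calc _ = L * ((Finset.univ.filter fun g : Equiv.Perm α =>
        g.cycleType = L ::ₘ S.val).card * ∏ p ∈ S, p) := by ring
    _ ≤ _ := Nat.mul_le_mul_right _ (Nat.sub_le _ _)

lemma two_pow_mul_factorial_le_sum_orderOf {α : Type*} [Fintype α] [DecidableEq α] {y : ℕ} {P : Finset ℕ}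
    (hP : ∀ p ∈ P, p.Prime ∧ p ≤ y) (hy : (P.card + 1) * y + 2 ≤ Fintype.card α) :
    2 ^ P.card * (Fintype.card α).factorial ≤
      Fintype.card α * ∑ τ : Equiv.Perm α, orderOf τ := by
  have hle : ∀ S ∈ P.powerset, (S.card + 1) * y + 2 ≤ Fintype.card α := fun S hS => by
    have := Finset.card_le_card (Finset.mem_powerset.1 hS)
    have := Nat.mul_le_mul_right y (Nat.add_le_add_right this 1)
    omega
  set C : Finset ℕ → Finset (Equiv.Perm α) := fun S => Finset.univ.filter
    fun g => g.cycleType = (Fintype.card α - ∑ p ∈ S, p) ::ₘ S.val with hC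
  have hrec : ∀ S ∈ P.powerset, ∀ g ∈ C S, S = g.cycleType.toFinset.filter fun a => a ≤ y := by
    intro S hS g hg
    rw [hC, Finset.mem_filter] at hg
    rw [hg.2]
    have hsum : ∑ p ∈ S, p ≤ S.card * y := by
      simpa using Finset.sum_le_card_nsmul S (fun p => p) y
        fun p hp => (hP p (Finset.mem_powerset.1 hS hp)).2
    have h1 := hle S hS
    have h2 : (S.card + 1) * y = S.card * y + y := by ring
    ext a
    simp only [Multiset.toFinset_cons, Finset.mem_filter, Finset.mem_insert, Multiset.mem_toFinset,
      Finset.mem_val]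
    constructor
    · exact fun ha => ⟨Or.inr ha, (hP a (Finset.mem_powerset.1 hS ha)).2⟩
    · rintro ⟨rfl | ha, hay⟩
      · omega
      · exact ha
  have hdisj : (P.powerset : Set (Finset ℕ)).PairwiseDisjoint C := by
    intro S hS S' hS' hne
    refine Finset.disjoint_left.2 fun g hg hg' => hne ?_
    rw [hrec S hS g hg, ← hrec S' hS' g hg']
  calc 2 ^ P.card * (Fintype.card α).factorial
      = ∑ S ∈ P.powerset, (Fintype.card α).factorial := by
        rw [Finset.sum_const, Finset.card_powerset, smul_eq_mul]
    _ ≤ ∑ S ∈ P.powerset, Fintype.card α * ((C S).card * ∏ p ∈ S, p) :=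
        Finset.sum_le_sum fun S hS => card_le_card_cycleType_mul_prod
          (fun p hp => hP p (Finset.mem_powerset.1 hS hp)) (hle S hS)
    _ = Fintype.card α * ∑ S ∈ P.powerset, ∑ g ∈ C S, ∏ p ∈ S, p := by
        rw [Finset.mul_sum]
        simp only [Finset.sum_const, smul_eq_mul]
    _ ≤ Fintype.card α * ∑ S ∈ P.powerset, ∑ g ∈ C S, orderOf g := by
        refine Nat.mul_le_mul_left _ (Finset.sum_le_sum fun S hS => Finset.sum_le_sum fun g hg => ?_)
        exact le_orderOf_of_cycleType (fun p hp => (hP p (Finset.mem_powerset.1 hS hp)).1)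
          (Finset.mem_filter.1 hg).2
    _ = Fintype.card α * ∑ g ∈ P.powerset.biUnion C, orderOf g := by
        rw [Finset.sum_biUnion hdisj]
    _ ≤ _ := Nat.mul_le_mul_left _ (Finset.sum_le_sum_of_subset (Finset.subset_univ _))

lemma card_image_mul_of_isZKMap {n k : ℕ} {h : Fin n → Fin n} (hh : IsZKMap k h) :
    (Finset.univ.image h).card * k = n := by
  have := Finset.card_eq_sum_card_image h Finset.univ
  rw [Finset.card_univ, Fintype.card_fin] at this
  refine Eq.trans ?_ this.symm
  rw [← smul_eq_mul, ← Finset.sum_const]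
  refine Finset.sum_congr rfl fun y hy => ?_
  obtain ⟨x, -, hx⟩ := Finset.mem_image.1 hy
  rcases hh y with h0 | h0
  · exact absurd (Finset.card_eq_zero.1 h0)
      (Finset.ne_empty_of_mem (Finset.mem_filter.2 ⟨Finset.mem_univ x, hx⟩))
  · rw [h0]

lemma descFactorial_mul_pow_le_card_injective {n k r : ℕ} (hk : 0 < k) (hn : n = k * r)
    {h : Fin n → Fin n} (hh : IsZKMap k h) (ι : Type*) [Fintype ι] [DecidableEq ι] :
    r.descFactorial (Fintype.card ι) * k ^ Fintype.card ι ≤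
      (Finset.univ.filter fun u : ι → Fin n => Function.Injective (h ∘ u)).card := by
  set R := Finset.univ.image h with hR
  have hRcard : R.card = r := by
    have := card_image_mul_of_isZKMap hh
    exact Nat.eq_of_mul_eq_mul_right hk (by rw [this, hn, mul_comm])
  have hfib : ∀ y : R, Nonempty (Fin k ≃ {x // h x = y.1}) := by
    intro y
    refine ⟨(Fintype.equivFinOfCardEq ?_).symm⟩
    obtain ⟨x, -, hx⟩ := Finset.mem_image.1 y.2
    rw [Fintype.card_subtype]
    rcases hh y with h0 | h0
    · exact absurd (Finset.card_eq_zero.1 h0)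
        (Finset.ne_empty_of_mem (Finset.mem_filter.2 ⟨Finset.mem_univ x, hx⟩))
    · exact h0
  have e := fun y => (hfib y).some
  have hcard : Fintype.card ((ι ↪ R) × (ι → Fin k)) =
      r.descFactorial (Fintype.card ι) * k ^ Fintype.card ι := by
    rw [Fintype.card_prod, Fintype.card_embedding_eq, Fintype.card_coe, hRcard,
      Fintype.card_fun, Fintype.card_fin]
  rw [← hcard, ← Finset.card_univ]
  have hval : ∀ (y : R) (c : Fin k), h (e y c) = y := fun y c => (e y c).2
  refine Finset.card_le_card_of_injOn (fun p i => (e (p.1 i) (p.2 i) : Fin n)) ?_ ?_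
  · intro p _
    simp only [Finset.coe_filter, Finset.mem_univ, true_and, Set.mem_ofPred_eq]
    intro i j hij
    simp only [Function.comp_apply, hval] at hij
    exact p.1.injective (Subtype.ext hij)
  · rintro ⟨x, c⟩ - ⟨x', c'⟩ - hp
    have hx : x = x' := by
      ext i : 2
      have := congrArg h (congrFun hp i)
      simpa only [hval] using this
    subst hx
    have hc : c = c' := by
      ext i : 1
      exact (e (x i)).injective (Subtype.ext (congrFun hp i))
    rw [hc]

lemma factorial_le_card_perm_extending {α ι : Type*} [Fintype α] [DecidableEq α] [Fintype ι]
    {x z : ι → α}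
    (hx : Function.Injective x) (hz : Function.Injective z) :
    (Fintype.card α - Fintype.card ι).factorial ≤
      (Finset.univ.filter fun ρ : Equiv.Perm α => ∀ i, ρ (x i) = z i).card := by
  set e : {a // a ∈ Set.range x} ≃ {a // a ∈ Set.range z} :=
    (Equiv.ofInjective x hx).symm.trans (Equiv.ofInjective z hz) with he
  have hext : ∀ i, e.extendSubtype (x i) = z i := by
    intro i
    rw [Equiv.extendSubtype_apply_of_mem _ _ ⟨i, rfl⟩, he, Equiv.trans_apply]
    have : (⟨x i, ⟨i, rfl⟩⟩ : Set.range x) = Equiv.ofInjective x hx i := rfl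
    rw [this, Equiv.symm_apply_apply]
    rfl
  have hcard : Fintype.card {a // a ∉ Set.range x} = Fintype.card α - Fintype.card ι := by
    rw [Fintype.card_subtype_compl]
    congr 1
    exact (Fintype.card_congr (Equiv.ofInjective x hx)).symm
  rw [← hcard, ← Fintype.card_perm, ← Finset.card_univ]
  refine Finset.card_le_card_of_injOn
    (fun σ => e.extendSubtype * Equiv.Perm.ofSubtype σ) ?_ ?_
  · intro σ _
    simp only [Finset.coe_filter, Finset.mem_univ, true_and, Set.mem_ofPred_eq]
    intro i
    rw [Equiv.Perm.mul_apply, Equiv.Perm.ofSubtype_apply_of_not_mem σ (by simp), hext]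
  · intro σ _ σ' _ hσ
    exact Equiv.Perm.ofSubtype_injective (mul_left_cancel hσ)

lemma card_le_of_succ_eq {n m : ℕ} [NeZero m] (g : Fin n → Fin n) :
    (Finset.univ.filter fun u : ZMod m → Fin n => ∀ i, g (u i) = u (i + 1)).card ≤ n := by
  conv_rhs => rw [← Fintype.card_fin n, ← Finset.card_univ]
  refine Finset.card_le_card_of_injOn (fun u => u 0) (fun _ _ => Finset.mem_univ _) ?_
  have key : ∀ u : ZMod m → Fin n, (∀ i, g (u i) = u (i + 1)) →
      ∀ j : ℕ, u j = g^[j] (u 0) := by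
    intro u hu j
    induction j with
    | zero => simp
    | succ j ih => rw [Function.iterate_succ_apply', ← ih, hu, Nat.cast_succ]
  intro u hu u' hu' h0
  ext i : 1
  rw [← ZMod.natCast_zmod_val i, key u (Finset.mem_filter.1 hu).2,
    key u' (Finset.mem_filter.1 hu').2]
  exact congrArg _ h0

lemma le_Zmap_of_succ_eq {n m : ℕ} [NeZero m] {f : Fin n → Fin n} {x : ZMod m → Fin n}
    (hx : Function.Injective x) (h : ∀ i, f (x i) = x (i + 1)) : m ≤ Zmap f := by
  have key : ∀ (j : ℕ) (i : ZMod m), f^[j] (x i) = x (i + j) := by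
    intro j i
    induction j with
    | zero => simp
    | succ j ih => rw [Function.iterate_succ_apply', ih, h, Nat.cast_succ, add_assoc]
  have : (Finset.univ.image x).card = m := by
    rw [Finset.card_image_of_injective _ hx, Finset.card_univ, ZMod.card]
  rw [← this]
  refine Finset.card_le_card fun y hy => ?_
  obtain ⟨i, -, rfl⟩ := Finset.mem_image.1 hy
  rw [cyclicSet, Finset.mem_filter]
  exact ⟨Finset.mem_univ _, m, NeZero.pos m, by rw [key]; simp⟩

lemma factorial_le_card_perm_succ {n m : ℕ} [NeZero m] {h : Fin n → Fin n}
    {u : ZMod m → Fin n} (hu : Function.Injective (h ∘ u)) :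
    (n - m).factorial ≤ (Finset.univ.filter fun ρ : Equiv.Perm (Fin n) =>
      ∀ i, ρ (h (u i)) = u (i + 1)).card := by
  have := factorial_le_card_perm_extending (x := h ∘ u) (z := fun i => u (i + 1)) hu
    (hu.of_comp.comp (add_left_injective 1))
  rw [ZMod.card, Fintype.card_fin] at this
  exact this

lemma card_injective_succ_le {n m : ℕ} [NeZero m] (h : Fin n → Fin n)
    (ρ : Equiv.Perm (Fin n)) :
    ((Finset.univ.filter fun u : ZMod m → Fin n => Function.Injective (h ∘ u)).filter
      fun u => ∀ i, ρ (h (u i)) = u (i + 1)).card ≤ if m ≤ Zmap (h ∘ ρ) then n else 0 := by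
  split_ifs with hρ
  · refine (Finset.card_le_card ?_).trans (card_le_of_succ_eq (m := m) (ρ ∘ h))
    intro u hu
    exact Finset.mem_filter.2 ⟨Finset.mem_univ _, (Finset.mem_filter.1 hu).2⟩
  · rw [Nat.le_zero, Finset.card_eq_zero]
    refine Finset.eq_empty_of_forall_notMem fun u hu => hρ ?_
    rw [Finset.mem_filter, Finset.mem_filter] at hu
    exact le_Zmap_of_succ_eq hu.1.2 fun i => by simp [hu.2]

lemma mul_factorial_le_card_perm {n k r m : ℕ} [NeZero m] (hk : 0 < k) (hn : n = k * r)
    {h : Fin n → Fin n} (hh : IsZKMap k h) :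
    r.descFactorial m * k ^ m * (n - m).factorial ≤
      n * (Finset.univ.filter fun ρ : Equiv.Perm (Fin n) => m ≤ Zmap (h ∘ ρ)).card := by
  have hU := descFactorial_mul_pow_le_card_injective hk hn hh (ZMod m)
  rw [ZMod.card] at hU
  have hle : ∀ u ∈ (Finset.univ.filter fun u : ZMod m → Fin n => Function.Injective (h ∘ u)),
      (n - m).factorial ≤ (Finset.univ.filter fun ρ : Equiv.Perm (Fin n) =>
        ∀ i, ρ (h (u i)) = u (i + 1)).card := fun u hu =>
    factorial_le_card_perm_succ (Finset.mem_filter.1 hu).2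
  have hge : ∀ ρ ∈ (Finset.univ : Finset (Equiv.Perm (Fin n))),
      ((Finset.univ.filter fun u : ZMod m → Fin n => Function.Injective (h ∘ u)).filter
        fun u => ∀ i, ρ (h (u i)) = u (i + 1)).card ≤ if m ≤ Zmap (h ∘ ρ) then n else 0 :=
    fun ρ _ => card_injective_succ_le h ρ
  generalize (Finset.univ.filter fun u : ZMod m → Fin n => Function.Injective (h ∘ u)) = U
    at hU hle hge
  have h1 := Finset.card_nsmul_le_sum U _ _ hle
  have h2 := Finset.sum_le_sum hge
  rw [← Finset.sum_filter, Finset.sum_const, smul_eq_mul, mul_comm] at h2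
  have h3 : ∑ u ∈ U, (Finset.univ.filter fun ρ : Equiv.Perm (Fin n) =>
        ∀ i, ρ (h (u i)) = u (i + 1)).card =
      ∑ ρ : Equiv.Perm (Fin n), (U.filter fun u => ∀ i, ρ (h (u i)) = u (i + 1)).card := by
    simp_rw [Finset.card_filter]
    exact Finset.sum_comm
  exact (Nat.mul_le_mul_right _ hU).trans (h1.trans (h3.le.trans h2))

lemma card_zkMaps_mul_le {n k r m : ℕ} [NeZero m] (hk : 0 < k) (hn : n = k * r) :
    (zkMaps n k).card * (r.descFactorial m * k ^ m * (n - m).factorial) ≤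
      n * (n.factorial * ((zkMaps n k).filter fun f => m ≤ Zmap f).card) := by
  have hρ : ∀ ρ : Equiv.Perm (Fin n), ((zkMaps n k).filter fun h => m ≤ Zmap (h ∘ ρ)).card =
      ((zkMaps n k).filter fun f => m ≤ Zmap f).card := by
    intro ρ
    refine Finset.card_nbij' (fun f => f ∘ ρ) (fun f => f ∘ ρ.symm) ?_ ?_ ?_ ?_
    · intro f hf
      rw [Finset.mem_coe, Finset.mem_filter] at *
      exact ⟨comp_perm_mem_zkMaps hf.1 ρ, hf.2⟩
    · intro f hf
      rw [Finset.mem_coe, Finset.mem_filter] at *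
      refine ⟨comp_perm_mem_zkMaps hf.1 ρ.symm, ?_⟩
      simpa [Function.comp_assoc] using hf.2
    · intro f _
      simp [Function.comp_assoc]
    · intro f _
      simp [Function.comp_assoc]
  calc _ = ∑ h ∈ zkMaps n k, r.descFactorial m * k ^ m * (n - m).factorial := by
        rw [Finset.sum_const, smul_eq_mul]
    _ ≤ ∑ h ∈ zkMaps n k, n * (Finset.univ.filter
          fun ρ : Equiv.Perm (Fin n) => m ≤ Zmap (h ∘ ρ)).card :=
        Finset.sum_le_sum fun h hh => mul_factorial_le_card_perm hk hn (Finset.mem_filter.1 hh).2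
    _ = n * ∑ ρ : Equiv.Perm (Fin n), ((zkMaps n k).filter fun h => m ≤ Zmap (h ∘ ρ)).card := by
        rw [← Finset.mul_sum]
        congr 1
        exact Finset.sum_card_bipartiteAbove_eq_sum_card_bipartiteBelow
          (fun (h : Fin n → Fin n) (ρ : Equiv.Perm (Fin n)) => m ≤ Zmap (h ∘ ρ))
    _ = _ := by
        simp_rw [hρ]
        rw [Finset.sum_const, smul_eq_mul, Finset.card_univ, Fintype.card_perm, Fintype.card_fin]

lemma zkMaps_nonempty {k r : ℕ} (hk : 0 < k) : (zkMaps (k * r) k).Nonempty := by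
  have hlt : ∀ x : Fin (k * r), (x : ℕ) / k < k * r := fun x =>
    (Nat.div_le_self _ _).trans_lt x.2
  refine ⟨fun x => ⟨x / k, hlt x⟩, Finset.mem_filter.2 ⟨Finset.mem_univ _, fun y => ?_⟩⟩
  rcases lt_or_ge (y : ℕ) r with hy | hy
  · right
    have hb : ∀ c : Fin k, y * k + (c : ℕ) < k * r := by
      intro c
      have := c.2
      calc y * k + (c : ℕ) < y * k + k := by omega
        _ = k * (y + 1) := by ring
        _ ≤ k * r := Nat.mul_le_mul_left _ hy
    conv_rhs => rw [← Fintype.card_fin k, ← Finset.card_univ]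
    symm
    refine Finset.card_bij (fun c _ => ⟨y * k + c, hb c⟩) ?_ ?_ ?_
    · intro c _
      rw [Finset.mem_filter]
      refine ⟨Finset.mem_univ _, Fin.ext ?_⟩
      simp only
      rw [mul_comm, Nat.mul_add_div hk, Nat.div_eq_of_lt c.2, add_zero]
    · intro c _ c' _ h
      have := Fin.mk.inj h
      exact Fin.ext (by omega)
    · intro x hx
      have hx' : (x : ℕ) / k = y := congrArg Fin.val (Finset.mem_filter.1 hx).2
      refine ⟨⟨x % k, Nat.mod_lt _ hk⟩, Finset.mem_univ _, Fin.ext ?_⟩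
      simp only
      rw [← hx', mul_comm, Nat.div_add_mod]
  · left
    rw [Finset.card_eq_zero]
    refine Finset.eq_empty_of_forall_notMem fun x hx => ?_
    have hx' : (x : ℕ) / k = y := congrArg Fin.val (Finset.mem_filter.1 hx).2
    have : (x : ℕ) / k < r := Nat.div_lt_of_lt_mul x.2
    omega

lemma le_zkExp_Tmap {k r m y : ℕ} [NeZero m] (hk : 0 < k) (hr : 0 < r) {P : Finset ℕ}
    (hP : ∀ p ∈ P, p.Prime ∧ p ≤ y) (hy : (P.card + 1) * y + 2 ≤ m) (hmr : m ≤ r) :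
    (1 - (m : ℝ) / r) ^ m * 2 ^ P.card / ((k * r : ℕ) : ℝ) ^ 2 ≤
      zkExp (k * r) k fun g => (Tmap g : ℝ) := by
  set n := k * r with hn
  have hn0 : 0 < n := Nat.mul_pos hk hr
  have hnR : (0 : ℝ) < n := by exact_mod_cast hn0
  have hrR : (0 : ℝ) < r := by exact_mod_cast hr
  have hmn : m ≤ n := hmr.trans (Nat.le_mul_of_pos_left r hk)
  set L : ℝ := 2 ^ P.card / n with hL
  have hL0 : 0 ≤ L := by positivity
  have h1 := le_sum_Tmap (n := n) (k := k) (m := m) (L := L) fun A hA => by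
    have h := two_pow_mul_factorial_le_sum_orderOf (α := A) hP
      (by rw [Fintype.card_coe]; exact hy.trans hA)
    rw [Fintype.card_coe] at h
    have hAn : A.card ≤ n := (Finset.card_le_univ A).trans (by simp)
    have h' : ((2 ^ P.card * A.card.factorial : ℕ) : ℝ) ≤
        ((n * ∑ τ : Equiv.Perm A, orderOf τ : ℕ) : ℝ) := by
      exact_mod_cast h.trans (Nat.mul_le_mul_right _ hAn)
    push_cast at h'
    rw [hL, mul_div_assoc', div_le_iff₀ hnR]
    linarith
  set G := (zkMaps n k).filter fun f => m ≤ Zmap f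
  have h2 := card_zkMaps_mul_le (m := m) hk hn
  rw [← Nat.factorial_mul_descFactorial hmn] at h2
  have hzk : (0 : ℝ) < (zkMaps n k).card := by
    exact_mod_cast Finset.card_pos.2 (zkMaps_nonempty hk)
  have h3 : (zkMaps n k).card * (r.descFactorial m * k ^ m) ≤
      n * (n.descFactorial m * G.card) := by
    refine Nat.le_of_mul_le_mul_left ?_ (Nat.factorial_pos (n - m))
    calc _ = (zkMaps n k).card * (r.descFactorial m * k ^ m * (n - m).factorial) := by ring
      _ ≤ _ := h2
      _ = _ := by ring
  have h4 : ((zkMaps n k).card : ℝ) * ((1 - (m : ℝ) / r) ^ m * n ^ m) ≤ n * (n ^ m * G.card) := by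
    have hd : (r - m) ^ m ≤ r.descFactorial m :=
      (Nat.pow_le_pow_left (by omega) m).trans (Nat.pow_sub_le_descFactorial r m)
    have h5 : (zkMaps n k).card * ((r - m) ^ m * k ^ m) ≤ n * (n ^ m * G.card) :=
      (Nat.mul_le_mul_left _ (Nat.mul_le_mul_right _ hd)).trans (h3.trans
        (Nat.mul_le_mul_left _ (Nat.mul_le_mul_right _ (Nat.descFactorial_le_pow n m))))
    have h6 : (((zkMaps n k).card * ((r - m) ^ m * k ^ m) : ℕ) : ℝ) ≤
        ((n * (n ^ m * G.card) : ℕ) : ℝ) := by exact_mod_cast h5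
    push_cast [Nat.cast_sub hmr] at h6
    have h7 : (1 - (m : ℝ) / r) ^ m * (n : ℝ) ^ m = ((r : ℝ) - m) ^ m * (k : ℝ) ^ m := by
      rw [← mul_pow, ← mul_pow, hn]
      congr 1
      push_cast
      field_simp
    rwa [h7]
  have h5 : ((zkMaps n k).card : ℝ) * (1 - (m : ℝ) / r) ^ m ≤ n * G.card := by
    refine le_of_mul_le_mul_right ?_ (pow_pos hnR m)
    linarith
  rw [zkExp, le_div_iff₀ hzk]
  refine le_trans ?_ h1
  rw [hL]
  calc _ = ((zkMaps n k).card : ℝ) * (1 - (m : ℝ) / r) ^ m * (2 ^ P.card / (n : ℝ) ^ 2) := by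
        ring
    _ ≤ n * G.card * (2 ^ P.card / (n : ℝ) ^ 2) :=
        mul_le_mul_of_nonneg_right h5 (by positivity)
    _ = _ := by field_simp

lemma exp_neg_two_mul_le {t : ℝ} (h0 : 0 ≤ t) (h1 : t ≤ 1 / 2) : Real.exp (-(2 * t)) ≤ 1 - t := by
  rw [Real.exp_neg]
  refine inv_le_of_inv_le₀ (by linarith) ?_
  have h2 : (1 - t)⁻¹ ≤ 2 * t + 1 := by
    rw [inv_le_iff_one_le_mul₀ (by linarith)]
    nlinarith
  exact h2.trans (Real.add_one_le_exp _)

lemma exists_primes_card_eq {y d : ℕ} (h : d ≤ Nat.primeCounting y) :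
    ∃ P : Finset ℕ, (∀ p ∈ P, p.Prime ∧ p ≤ y) ∧ P.card = d := by
  rw [Nat.primeCounting, Nat.primeCounting', Nat.count_eq_card_filter_range] at h
  obtain ⟨P, hP, hd⟩ := Finset.exists_subset_card_eq h
  refine ⟨P, fun p hp => ?_, hd⟩
  have := Finset.mem_filter.1 (hP hp)
  exact ⟨this.2, by have := Finset.mem_range.1 this.1; omega⟩

lemma zkExp_Tmap_pos_and_le_log {k r y d : ℕ} (hk : 0 < k) (hr : 0 < r)
    (hd : d ≤ Nat.primeCounting y) (hmr : 2 * ((d + 1) * y + 2) ≤ r) :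
    0 < zkExp (k * r) k (fun g => (Tmap g : ℝ)) ∧
    d * Real.log 2 - 2 * Real.log ((k * r : ℕ) : ℝ) -
        2 * (((d + 1) * y + 2 : ℕ) : ℝ) ^ 2 / r ≤
      Real.log (zkExp (k * r) k fun g => (Tmap g : ℝ)) := by
  obtain ⟨P, hP, hPd⟩ := exists_primes_card_eq hd
  set m := (d + 1) * y + 2 with hm
  have : NeZero m := ⟨by omega⟩
  have h := le_zkExp_Tmap (m := m) hk hr hP (by rw [hPd]) (by omega)
  have hrR : (0 : ℝ) < r := by exact_mod_cast hr
  have hnR : (0 : ℝ) < ((k * r : ℕ) : ℝ) := by exact_mod_cast Nat.mul_pos hk hr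
  have hmr' : (2 : ℝ) * m ≤ r := by exact_mod_cast hmr
  have ht : (m : ℝ) / r ≤ 1 / 2 := by rw [div_le_iff₀ hrR]; linarith
  have hexp : Real.exp (d * Real.log 2 - 2 * Real.log ((k * r : ℕ) : ℝ) - 2 * (m : ℝ) ^ 2 / r) ≤
      zkExp (k * r) k fun g => (Tmap g : ℝ) := by
    refine le_trans ?_ h
    calc _ = Real.exp (-(2 * (m / r : ℝ))) ^ m * 2 ^ P.card / ((k * r : ℕ) : ℝ) ^ 2 := by
          rw [Real.exp_sub, Real.exp_sub, hPd, mul_comm (d : ℝ), Real.exp_mul,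
            Real.exp_log two_pos, Real.rpow_natCast, mul_comm (2 : ℝ) (Real.log _),
            Real.exp_mul, Real.exp_log hnR, Real.rpow_ofNat, ← Real.exp_nat_mul,
            mul_neg, Real.exp_neg]
          have : (m : ℝ) * (2 * (m / r)) = 2 * (m : ℝ) ^ 2 / r := by ring
          rw [this]
          ring
      _ ≤ _ := by
          gcongr
          exact exp_neg_two_mul_le (by positivity) ht
  have hpos := (Real.exp_pos _).trans_le hexp
  exact ⟨hpos, (Real.le_log_iff_exp_le hpos).2 hexp⟩

lemma log_Tmap_le_of_Zmap_le {n : ℕ} (hn : 1 ≤ n) {s X : ℝ} (hs : 2 ≤ s) (hX : s ^ 9 ≤ X)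
    (hlog : Real.log n = s ^ 3) (hlogX : Real.log X = s ^ 3 / 3) (f : Fin n → Fin n)
    (hZ : (Zmap f : ℝ) ≤ X ^ 2 / s ^ 9) : Real.log (Tmap f) ≤ 20 * (X / s ^ 3) := by
  have hs0 : 0 < s := by linarith
  have hs1 : 1 ≤ s := by linarith
  have hX0 : 0 < X := (pow_pos hs0 9).trans_le hX
  set y := X / s ^ 3 with hy
  have hy0 : 0 < y := by positivity
  have hsq : √X ≤ y := by
    rw [hy, le_div_iff₀ (by positivity)]
    have h1 : s ^ 3 ≤ √X := Real.le_sqrt_of_sq_le (by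
      calc (s ^ 3) ^ 2 = s ^ 6 := by ring
        _ ≤ s ^ 9 := pow_le_pow_right₀ hs1 (by norm_num)
        _ ≤ X := hX)
    calc √X * s ^ 3 ≤ √X * √X := mul_le_mul_of_nonneg_left h1 (Real.sqrt_nonneg _)
      _ = X := Real.mul_self_sqrt hX0.le
  have hy1 : 1 < y := by
    refine lt_of_lt_of_le ?_ hsq
    rw [Real.lt_sqrt zero_le_one]
    exact lt_of_lt_of_le (by rw [one_pow]; exact one_lt_pow₀ (by linarith) (by norm_num)) hX
  have hlogy : s ^ 3 / 12 ≤ Real.log √y := by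
    rw [Real.log_sqrt hy0.le]
    have := Real.log_le_log (Real.sqrt_pos.2 hX0) hsq
    rw [Real.log_sqrt hX0.le, hlogX] at this
    linarith
  have hlog4 : Real.log 4 ≤ 1.4 := by
    have : Real.log 4 = 2 * Real.log 2 := by
      rw [show (4 : ℝ) = 2 ^ 2 by norm_num, Real.log_pow]; norm_num
    linarith [Real.log_two_lt_d9]
  have hpi : (Nat.primeCounting ⌊y⌋₊ : ℝ) ≤ 17.8 * (X / s ^ 6) := by
    refine (Chebyshev.pi_le_log4_mul_div hy1).trans ?_
    have h1 : Real.log 4 * y / Real.log √y ≤ 16.8 * (X / s ^ 6) := by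
      calc Real.log 4 * y / Real.log √y ≤ 1.4 * y / (s ^ 3 / 12) := by gcongr
        _ = 16.8 * (X / s ^ 6) := by rw [hy]; field_simp; norm_num
    have h2 : √y ≤ X / s ^ 6 := by
      rw [Real.sqrt_le_left (by positivity), hy, div_pow, div_le_div_iff₀ (by positivity)
        (by positivity)]
      calc X * (s ^ 6) ^ 2 = X * s ^ 3 * s ^ 9 := by ring
        _ ≤ X * s ^ 3 * X := by gcongr
        _ = X ^ 2 * s ^ 3 := by ring
    linarith
  have hZy : (Zmap f : ℝ) / y ≤ X / s ^ 6 := by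
    rw [div_le_iff₀ hy0]
    calc (Zmap f : ℝ) ≤ X ^ 2 / s ^ 9 := hZ
      _ = X / s ^ 6 * y := by rw [hy]; field_simp
  calc Real.log (Tmap f) ≤ (Nat.primeCounting ⌊y⌋₊ + Zmap f / y) * Real.log n :=
        log_Tmap_le hn f hy0
    _ ≤ (20 * (X / s ^ 6)) * s ^ 3 := by
        rw [hlog]
        have : 0 ≤ X / s ^ 6 := by positivity
        gcongr
        linarith
    _ = 20 * (X / s ^ 3) := by field_simp

lemma le_log_zkExp_Tmap {k r : ℕ} (hk : 0 < k) (hr : 0 < r) {s X : ℝ} (hs : 100 * k ≤ s)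
    (hX : s ^ 9 ≤ X) (hlog : Real.log ((k * r : ℕ) : ℝ) = s ^ 3)
    (hX3 : ((k * r : ℕ) : ℝ) = X ^ 3) :
    0 < zkExp (k * r) k (fun g => (Tmap g : ℝ)) ∧
      X / (160 * k * s ^ 2) ≤ Real.log (zkExp (k * r) k fun g => (Tmap g : ℝ)) := by
  have hkR : (1 : ℝ) ≤ k := by exact_mod_cast hk
  have hrR : (0 : ℝ) < r := by exact_mod_cast hr
  have hs100 : 100 ≤ s := by linarith
  have hs0 : 0 < s := by linarith
  have hs1 : 1 ≤ s := by linarith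
  have hpw : ∀ j ≤ 9, s ^ j ≤ X := fun j hj => (pow_le_pow_right₀ hs1 hj).trans hX
  have hX0 : 0 < X := (pow_pos hs0 9).trans_le hX
  have hX100 : 100 ≤ X := hs100.trans (by simpa using hpw 1 (by norm_num))
  set y := ⌊X * s⌋₊ with hy
  set d := ⌊X / (16 * k * s ^ 2)⌋₊ with hd
  have hy_le : (y : ℝ) ≤ X * s := Nat.floor_le (by positivity)
  have hy_ge : X * s - 1 < y := Nat.sub_one_lt_floor _
  have hd_le : (d : ℝ) ≤ X / (16 * k * s ^ 2) := Nat.floor_le (by positivity)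
  have hd_ge : X / (16 * k * s ^ 2) - 1 < d := Nat.sub_one_lt_floor _
  have hXs : 10000 ≤ X * s := by nlinarith
  have hy2 : (2 : ℝ) ≤ y := by linarith
  have hs3X : 4 * s ^ 3 ≤ X * s / 8 := by
    have h4 : s * s ^ 3 ≤ X := by simpa [← pow_succ'] using hpw 4 (by norm_num)
    have : 0 < s ^ 3 := by positivity
    nlinarith
  have hlogy1 : Real.log (y + 1) ≤ s ^ 3 := by
    rw [← hlog, hX3]
    refine Real.log_le_log (by linarith) ?_
    have h1 : s ≤ X := by simpa using hpw 1 (by norm_num)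
    have : X * s ≤ X * X := mul_le_mul_of_nonneg_left h1 hX0.le
    nlinarith [mul_pos hX0 hX0]
  have hdpi : d ≤ Nat.primeCounting y := by
    have h := Chebyshev.pi_ge y
    have hlogy : 0 < Real.log y := Real.log_pos (by linarith)
    have hlogy' : Real.log y ≤ s ^ 3 :=
      (Real.log_le_log (by linarith) (by linarith)).trans hlogy1
    have h2 : X / (4 * s ^ 2) ≤ (y * Real.log 2 - Real.log (y + 1)) / Real.log y := by
      rw [le_div_iff₀ hlogy]
      calc X / (4 * s ^ 2) * Real.log y ≤ X / (4 * s ^ 2) * s ^ 3 := by gcongr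
        _ = X * s / 4 := by field_simp
        _ ≤ _ := by nlinarith [Real.log_two_gt_d9]
    have h3 : X / (16 * k * s ^ 2) ≤ X / (4 * s ^ 2) := by
      gcongr
      linarith
    exact_mod_cast hd_le.trans (h3.trans (h2.trans h))
  set m := (d + 1) * y + 2 with hm
  have hm_le : (m : ℝ) ≤ X ^ 2 / (8 * k * s) := by
    have h1 : (m : ℝ) ≤ (X / (16 * k * s ^ 2) + 1) * (X * s) + 2 := by
      rw [hm]
      push_cast
      gcongr
    have h2 : X * s + 2 ≤ X ^ 2 / (16 * k * s) := by
      rw [le_div_iff₀ (by positivity)]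
      have h5 : 32 * k * s * s ≤ X := by
        calc 32 * k * s * s ≤ s * s * s := by gcongr; linarith
          _ = s ^ 3 := by ring
          _ ≤ X := hpw 3 (by norm_num)
      calc (X * s + 2) * (16 * k * s) ≤ (X * s + X * s) * (16 * k * s) := by
            gcongr
            linarith
        _ = X * (32 * k * s * s) := by ring
        _ ≤ X * X := by gcongr
        _ = X ^ 2 := by ring
    calc (m : ℝ) ≤ (X / (16 * k * s ^ 2) + 1) * (X * s) + 2 := h1
      _ = X ^ 2 / (16 * k * s) + (X * s + 2) := by field_simp; ring
      _ ≤ X ^ 2 / (16 * k * s) + X ^ 2 / (16 * k * s) := by gcongr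
      _ = X ^ 2 / (8 * k * s) := by field_simp; norm_num
  have hrX : (r : ℝ) = X ^ 3 / k := by
    rw [← hX3]
    push_cast
    field_simp
  have hmr : 2 * m ≤ r := by
    have : (2 : ℝ) * m ≤ r := by
      calc (2 : ℝ) * m ≤ 2 * (X ^ 2 / (8 * k * s)) := by gcongr
        _ = X ^ 2 / k * (1 / (4 * s)) := by field_simp; norm_num
        _ ≤ X ^ 2 / k * X := by
            gcongr
            rw [div_le_iff₀ (by positivity)]
            nlinarith
        _ = r := by rw [hrX]; ring
    exact_mod_cast this
  obtain ⟨hpos, hle⟩ := zkExp_Tmap_pos_and_le_log hk hr hdpi hmr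
  refine ⟨hpos, le_trans ?_ hle⟩
  rw [hlog, ← hm]
  set W := X / (16 * k * s ^ 2) with hW
  have hmm : 2 * (m : ℝ) ^ 2 / r ≤ W / 2 := by
    calc 2 * (m : ℝ) ^ 2 / r ≤ 2 * (X ^ 2 / (8 * k * s)) ^ 2 / r := by gcongr
      _ = W / 2 := by rw [hrX, hW]; field_simp; norm_num
  have hWs : s ^ 6 ≤ W := by
    rw [hW, le_div_iff₀ (by positivity)]
    calc s ^ 6 * (16 * k * s ^ 2) = 16 * k * s ^ 8 := by ring
      _ ≤ s * s ^ 8 := by gcongr; linarith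
      _ = s ^ 9 := by ring
      _ ≤ X := hX
  have hs36 : 1000 * s ^ 3 ≤ s ^ 6 := by
    have : (100 : ℝ) ^ 3 ≤ s ^ 3 := by gcongr
    nlinarith
  have hs31 : 1 ≤ s ^ 3 := one_le_pow₀ hs1
  have hfin : X / (160 * k * s ^ 2) = W / 10 := by rw [hW]; field_simp; norm_num
  rw [hfin]
  have hdl : (W - 1) * 0.69 ≤ d * Real.log 2 := by
    refine mul_le_mul hd_ge.le (by linarith [Real.log_two_gt_d9]) (by norm_num) (by positivity)
  linarith

/-- for large `r`, any `{0,k}`-mapping with at most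
`n^{2/3}/log³ n` cyclic nodes satisfies `T(f) < (E_n(T))^a`. -/
theorem stmt_16 (k : ℕ) (hk : 2 ≤ k) (a : ℕ → ℝ) (ha : ∀ r, 0 < a r)
    (hao : Tendsto
      (fun r : ℕ => (a r)⁻¹ * (Real.log ((k * r : ℕ) : ℝ)) ^ (-(1 : ℝ) / 3))
      atTop (nhds 0)) :
    ∀ᶠ r : ℕ in atTop, ∀ f : Fin (k * r) → Fin (k * r), IsZKMap k f →
      (Zmap f : ℝ) ≤ ((k * r : ℕ) : ℝ) ^ ((2 : ℝ) / 3) /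
        (Real.log ((k * r : ℕ) : ℝ)) ^ 3 →
      (Tmap f : ℝ) < (zkExp (k * r) k (fun g => (Tmap g : ℝ))) ^ (a r) := by
  have hk0 : 0 < k := by omega
  have hkR : (0 : ℝ) < k := by exact_mod_cast hk0
  have hN : Tendsto (fun r : ℕ => ((k * r : ℕ) : ℝ)) atTop atTop :=
    tendsto_natCast_atTop_atTop.comp (tendsto_id.const_mul_atTop' hk0)
  have hS : Tendsto (fun r : ℕ => Real.log ((k * r : ℕ) : ℝ) ^ ((1 : ℝ) / 3)) atTop atTop :=
    (tendsto_rpow_atTop (by norm_num)).comp (Real.tendsto_log_atTop.comp hN)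
  have hpow : ∀ᶠ s : ℝ in atTop, s ^ 9 ≤ Real.exp s := by
    have := (Real.isLittleO_pow_exp_atTop (n := 9)).bound one_pos
    filter_upwards [this] with s hs
    rw [one_mul, Real.norm_eq_abs, Real.norm_eq_abs, Real.abs_exp] at hs
    exact (le_abs_self _).trans hs
  filter_upwards [eventually_gt_atTop 0, hS.eventually_ge_atTop (100 * k), hS.eventually hpow,
    hao.eventually_lt_const (show (0 : ℝ) < 1 / (3200 * k) by positivity)]
    with r hr hs hs9 har f hf hZ
  have hkR1 : (1 : ℝ) ≤ k := by exact_mod_cast hk0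
  have hn : 1 ≤ k * r := Nat.mul_pos hk0 hr
  have hn0 : (0 : ℝ) < ((k * r : ℕ) : ℝ) := by exact_mod_cast hn
  have hn1 : (1 : ℝ) ≤ ((k * r : ℕ) : ℝ) := by exact_mod_cast hn
  set N := ((k * r : ℕ) : ℝ) with hNdef
  have hl0 : 0 ≤ Real.log N := Real.log_nonneg hn1
  set s := Real.log N ^ ((1 : ℝ) / 3) with hsdef
  have hs100 : 100 ≤ s := by linarith
  have hs0 : 0 < s := by linarith
  have hlog : Real.log N = s ^ 3 := by
    rw [hsdef, ← Real.rpow_natCast, ← Real.rpow_mul hl0]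
    norm_num
  set X := Real.exp (s ^ 3 / 3) with hXdef
  have hX0 : 0 < X := Real.exp_pos _
  have hlogX : Real.log X = s ^ 3 / 3 := Real.log_exp _
  have hX3 : N = X ^ 3 := by
    rw [hXdef, ← Real.exp_nat_mul, ← Real.exp_log hn0, hlog]
    congr 1
    push_cast
    ring
  have hX : s ^ 9 ≤ X := by
    refine hs9.trans (Real.exp_le_exp.2 ?_)
    nlinarith [mul_pos hs0 hs0, mul_pos (mul_pos hs0 hs0) hs0]
  have hX2 : N ^ ((2 : ℝ) / 3) = X ^ 2 := by
    rw [hX3, ← Real.rpow_natCast, ← Real.rpow_natCast, ← Real.rpow_mul hX0.le]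
    norm_num
  rw [hX2, hlog, ← pow_mul] at hZ
  have hT := log_Tmap_le_of_Zmap_le hn (by linarith) hX hlog hlogX f hZ
  obtain ⟨hE0, hE⟩ := le_log_zkExp_Tmap hk0 hr hs hX hlog hX3
  have hT0 : (0 : ℝ) < Tmap f := by exact_mod_cast Nat.pos_of_ne_zero (Tmap_ne_zero f)
  rw [← Real.log_lt_log_iff hT0 (Real.rpow_pos_of_pos hE0 _), Real.log_rpow hE0]
  have has : 3200 * k < a r * s := by
    have h1 : (a r)⁻¹ * Real.log N ^ (-(1 : ℝ) / 3) = (a r * s)⁻¹ := by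
      rw [neg_div, Real.rpow_neg hl0, mul_inv]
    rw [h1, one_div] at har
    exact (inv_lt_inv₀ (mul_pos (ha r) hs0) (by positivity)).1 har
  calc Real.log (Tmap f) ≤ 20 * (X / s ^ 3) := hT
    _ = 3200 * k * (X / (160 * k * s ^ 3)) := by field_simp; norm_num
    _ < a r * s * (X / (160 * k * s ^ 3)) := by gcongr
    _ = a r * (X / (160 * k * s ^ 2)) := by field_simp
    _ ≤ _ := mul_le_mul_of_nonneg_left hE (ha r).le
end
end

section
/- Fix an integer k ≥ 2 and let n = kr with r → ∞; let λ = k − 1 and α̃ = n^{1/3}/log³ n. Let b = b(n) be a sequence of positive reals with b^{−1}·log^{−2} n = o(1), and set ξ̃ = (E_n^{{0,k}}(B))^b. Then for all sufficiently large r, every {0,k}-mapping f on [n] whose number of cycles C(f) is less than α̃ satisfies B(f) < ξ̃. -/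
open Filter Finset Asymptotics MeasureTheory

noncomputable section

open scoped Classical

theorem IsZKMap.perm_comp {n k : ℕ} {f : Fin n → Fin n} (hf : IsZKMap k f)
    (τ : Equiv.Perm (Fin n)) : IsZKMap k (τ ∘ f) := by
  intro y
  have h : (univ.filter fun x => (τ ∘ f) x = y) = univ.filter fun x => f x = τ.symm y := by
    ext x
    simp [Equiv.eq_symm_apply]
  rw [h]
  exact hf _

theorem card_zkMaps_comp_eq_le {n k z : ℕ} (e e₁ e₂ : Fin z ↪ Fin n) :
    ((zkMaps n k).filter fun f => f ∘ e = e₁).card ≤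
      ((zkMaps n k).filter fun f => f ∘ e = e₂).card := by
  obtain ⟨τ, hτ⟩ := Equiv.Perm.exists_extending_pair e₁ e₂ e₁.injective e₂.injective
  refine Finset.card_le_card_of_injOn (fun f => τ ∘ f) ?_ ?_
  · intro f hf
    simp only [zkMaps, coe_filter, mem_filter, mem_univ, true_and, Set.mem_ofPred_eq] at hf ⊢
    refine ⟨hf.1.perm_comp τ, ?_⟩
    rw [Function.comp_assoc, hf.2]
    exact funext hτ
  · intro f _ g _ h
    exact τ.injective.comp_left h

/-- The number of maps extending a given partial injection depends only on its domain. -/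
theorem card_zkMaps_comp_mul {n k z : ℕ} (e e' : Fin z ↪ Fin n) :
    ((zkMaps n k).filter fun f => f ∘ e = e').card * n.descFactorial z =
      ((zkMaps n k).filter fun f => Function.Injective (f ∘ e)).card := by
  have key : ((zkMaps n k).filter fun f => Function.Injective (f ∘ e)) =
      (univ : Finset (Fin z ↪ Fin n)).biUnion
        fun e₁ => (zkMaps n k).filter fun f => f ∘ e = e₁ := by
    ext f
    simp only [mem_filter, mem_biUnion, mem_univ, true_and]
    constructor
    · rintro ⟨h, hi⟩
      exact ⟨⟨_, hi⟩, h, rfl⟩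
    · rintro ⟨e₁, h, hi⟩
      exact ⟨h, hi ▸ e₁.injective⟩
  rw [key, Finset.card_biUnion]
  · rw [Finset.sum_congr rfl fun e₁ _ => le_antisymm (card_zkMaps_comp_eq_le (k := k) e e₁ e')
      (card_zkMaps_comp_eq_le e e' e₁)]
    simp [Fintype.card_embedding_eq, mul_comm]
  · intro a _ b _ hab
    rw [Function.onFun, Finset.disjoint_left]
    intro f h1 h2
    simp only [mem_filter] at h1 h2
    exact hab (DFunLike.coe_injective (h1.2.symm.trans h2.2))

theorem IsZKMap.card_fiber {n k : ℕ} {f : Fin n → Fin n} (hf : IsZKMap k f) {y : Fin n}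
    (hy : y ∈ univ.image f) : (univ.filter fun x => f x = y).card = k := by
  obtain ⟨x, -, rfl⟩ := mem_image.1 hy
  refine (hf (f x)).resolve_left fun h => ?_
  rw [Finset.card_eq_zero] at h
  exact Finset.notMem_empty x (h ▸ by simp)

theorem IsZKMap.card_image {k r : ℕ} (hk : 0 < k) {f : Fin (k * r) → Fin (k * r)}
    (hf : IsZKMap k f) : (univ.image f).card = r := by
  have h := Finset.card_eq_sum_card_image f univ
  rw [Finset.sum_congr rfl fun y hy => hf.card_fiber hy] at h
  simp only [card_univ, Fintype.card_fin, sum_const, smul_eq_mul] at h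
  exact (Nat.eq_of_mul_eq_mul_left hk (h.trans (mul_comm _ _))).symm

theorem IsZKMap.card_injective_comp {k r z : ℕ} (hk : 0 < k) {f : Fin (k * r) → Fin (k * r)}
    (hf : IsZKMap k f) :
    (univ.filter fun e : Fin z ↪ Fin (k * r) => Function.Injective (f ∘ e)).card =
      k ^ z * r.descFactorial z := by
  have hmaps : ∀ e ∈ (univ.filter fun e : Fin z ↪ Fin (k * r) => Function.Injective (f ∘ e)),
      f ∘ e ∈ (univ : Finset (Fin z ↪ (univ.image f))).image fun g i => (g i : Fin (k * r)) := by
    intro e he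
    simp only [mem_filter, mem_univ, true_and] at he
    refine mem_image.2 ⟨⟨fun i => ⟨f (e i), mem_image_of_mem _ (mem_univ _)⟩, ?_⟩,
      mem_univ _, rfl⟩
    intro i j hij
    exact he (Subtype.ext_iff.1 hij)
  rw [Finset.card_eq_sum_card_fiberwise hmaps]
  have hfib : ∀ g ∈ (univ : Finset (Fin z ↪ (univ.image f))).image
      (fun g i => (g i : Fin (k * r))),
      ((univ.filter fun e : Fin z ↪ Fin (k * r) => Function.Injective (f ∘ e)).filter
        fun e : Fin z ↪ Fin (k * r) => f ∘ e = g).card = k ^ z := by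
    intro g hg
    obtain ⟨g', -, rfl⟩ := mem_image.1 hg
    have hc : (Fintype.piFinset fun i => univ.filter fun x => f x = (g' i : Fin (k * r))).card =
        k ^ z := by
      rw [Fintype.card_piFinset, Finset.prod_congr rfl fun i _ => hf.card_fiber (g' i).2]
      simp
    rw [← hc]
    refine Finset.card_bij (fun e _ => ⇑e) ?_ ?_ ?_
    · intro e he
      simp only [mem_filter, mem_univ, true_and] at he
      simp only [Fintype.mem_piFinset, mem_filter, mem_univ, true_and]
      exact fun i => congrFun he.2 i
    · intro e _ e₁ _ h
      exact DFunLike.coe_injective h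
    · intro e he
      simp only [Fintype.mem_piFinset, mem_filter, mem_univ, true_and] at he
      have hfe : f ∘ e = fun i => (g' i : Fin (k * r)) := funext he
      have hi : Function.Injective (f ∘ e) := by
        rw [hfe]
        exact Subtype.val_injective.comp g'.injective
      exact ⟨⟨e, hi.of_comp⟩, by simpa using ⟨hi, hfe⟩, rfl⟩
  rw [Finset.sum_congr rfl hfib, Finset.sum_const, Finset.card_image_of_injective]
  · rw [card_univ, Fintype.card_embedding_eq, Fintype.card_coe, hf.card_image hk]
    simp [mul_comm]
  · intro g₁ g₂ h
    ext i
    exact congrArg Fin.val (congrFun h i)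

/-- The total number of pairs of a `{0,k}`-mapping and an embedding of `Fin z` intertwining it
with a given permutation. -/
theorem sum_card_intertwining {k r z : ℕ} (hk : 0 < k) (σ : Equiv.Perm (Fin z)) :
    (∑ f ∈ zkMaps (k * r) k,
        (univ.filter fun e : Fin z ↪ Fin (k * r) => f ∘ e = e ∘ σ).card) *
      (k * r).descFactorial z = (zkMaps (k * r) k).card * (k ^ z * r.descFactorial z) := by
  have h1 : ∑ f ∈ zkMaps (k * r) k,
      (univ.filter fun e : Fin z ↪ Fin (k * r) => f ∘ e = e ∘ σ).card =
      ∑ e : Fin z ↪ Fin (k * r), ((zkMaps (k * r) k).filter fun f => f ∘ e = e ∘ σ).card := by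
    simp only [Finset.card_filter]
    exact Finset.sum_comm
  have h2 : ∑ f ∈ zkMaps (k * r) k,
      (univ.filter fun e : Fin z ↪ Fin (k * r) => Function.Injective (f ∘ e)).card =
      ∑ e : Fin z ↪ Fin (k * r),
        ((zkMaps (k * r) k).filter fun f => Function.Injective (f ∘ e)).card := by
    simp only [Finset.card_filter]
    exact Finset.sum_comm
  rw [h1, Finset.sum_mul]
  have h3 : ∀ e : Fin z ↪ Fin (k * r), ((zkMaps (k * r) k).filter fun f => f ∘ e = e ∘ σ).card *
      (k * r).descFactorial z =
        ((zkMaps (k * r) k).filter fun f => Function.Injective (f ∘ e)).card :=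
    fun e => card_zkMaps_comp_mul e (σ.toEmbedding.trans e)
  have h4 : ∀ f ∈ zkMaps (k * r) k,
      (univ.filter fun e : Fin z ↪ Fin (k * r) => Function.Injective (f ∘ e)).card =
        k ^ z * r.descFactorial z :=
    fun f hf => IsZKMap.card_injective_comp hk (Finset.mem_filter.1 hf).2
  rw [Finset.sum_congr rfl fun e _ => h3 e, ← h2, Finset.sum_congr rfl h4]
  simp

/-- The product over the cycles of `f` of the cycle length minus one. -/
def cycleWeight {n : ℕ} (f : Fin n → Fin n) : ℕ := ∏ c ∈ cyclesOf f, (c.card - 1)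

theorem nonempty_of_mem_cyclesOf {n : ℕ} {f : Fin n → Fin n} {c : Finset (Fin n)}
    (hc : c ∈ cyclesOf f) : c.Nonempty := by
  obtain ⟨x, hx, rfl⟩ := mem_image.1 hc
  exact ⟨x, mem_filter.2 ⟨hx, 0, rfl⟩⟩

theorem sum_powerset_cyclesOf {n : ℕ} (f : Fin n → Fin n) :
    ∑ T ∈ (cyclesOf f).powerset, ∏ c ∈ T, (c.card - 1) = Bmap f := by
  rw [← Finset.prod_one_add, Bmap]
  refine Finset.prod_congr rfl fun c hc => ?_
  have := (nonempty_of_mem_cyclesOf hc).card_pos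
  omega

theorem mem_cyclicSet_perm {n : ℕ} (σ : Equiv.Perm (Fin n)) (x : Fin n) : x ∈ cyclicSet σ := by
  refine mem_filter.2 ⟨mem_univ _, orderOf σ, orderOf_pos σ, ?_⟩
  rw [← Equiv.Perm.coe_pow, pow_orderOf_eq_one]
  rfl

theorem mem_biUnion_cyclesOf_perm {n : ℕ} (σ : Equiv.Perm (Fin n)) (x : Fin n) :
    ∃ c ∈ cyclesOf σ, x ∈ c :=
  ⟨_, mem_image_of_mem _ (mem_cyclicSet_perm σ x),
    mem_filter.2 ⟨mem_cyclicSet_perm σ x, 0, rfl⟩⟩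

theorem image_map_cyclesOf_subset {n z : ℕ} {f : Fin n → Fin n} {σ : Equiv.Perm (Fin z)}
    {e : Fin z ↪ Fin n} (h : f ∘ e = e ∘ σ) :
    (cyclesOf σ).image (Finset.map e) ⊆ cyclesOf f := by
  have hs : ∀ m i, f^[m] (e i) = e (σ^[m] i) := fun m i =>
    ((Function.Semiconj.iterate_right (f := e) (ga := σ) (gb := f)
      (fun j => (congrFun h j).symm) m) i).symm
  have hcyc : ∀ i, e i ∈ cyclicSet f := by
    intro i
    obtain ⟨m, hm, hi⟩ := (mem_filter.1 (mem_cyclicSet_perm σ i)).2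
    exact mem_filter.2 ⟨mem_univ _, m, hm, by rw [hs, hi]⟩
  intro c hc
  obtain ⟨d, hd, rfl⟩ := mem_image.1 hc
  obtain ⟨x, -, rfl⟩ := mem_image.1 hd
  refine mem_image.2 ⟨e x, hcyc x, ?_⟩
  ext y
  simp only [mem_filter, Finset.mem_map]
  constructor
  · rintro ⟨-, m, rfl⟩
    exact ⟨σ^[m] x, ⟨mem_cyclicSet_perm _ _, m, rfl⟩, (hs m x).symm⟩
  · rintro ⟨w, ⟨-, m, rfl⟩, rfl⟩
    exact ⟨hcyc _, m, hs m x⟩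

/-- Every intertwining embedding selects a set of cycles, each set being selected at most `z!`
times. -/
theorem sum_cycleWeight_le {n : ℕ} (z : ℕ) (f : Fin n → Fin n) :
    ∑ σ : Equiv.Perm (Fin z),
      (univ.filter fun e : Fin z ↪ Fin n => f ∘ e = e ∘ σ).card * cycleWeight σ ≤
      z.factorial * Bmap f := by
  set P : Finset (Equiv.Perm (Fin z) × (Fin z ↪ Fin n)) :=
    univ.filter fun p => f ∘ p.2 = p.2 ∘ p.1 with hP
  have hPm : ∀ p, p ∈ P ↔ f ∘ p.2 = p.2 ∘ p.1 := fun p => by simp [hP]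
  have h1 : ∑ σ : Equiv.Perm (Fin z),
      (univ.filter fun e : Fin z ↪ Fin n => f ∘ e = e ∘ σ).card * cycleWeight σ =
      ∑ p ∈ P, cycleWeight p.1 := by
    rw [hP, Finset.sum_filter, Fintype.sum_prod_type]
    refine Finset.sum_congr rfl fun σ _ => ?_
    rw [← Finset.sum_filter]
    exact (Finset.sum_const _).symm
  have hmaps : ∀ p ∈ P, (cyclesOf p.1).image (Finset.map p.2) ∈ (cyclesOf f).powerset :=
    fun p hp => mem_powerset.2 (image_map_cyclesOf_subset ((hPm p).1 hp))
  rw [h1, ← Finset.sum_fiberwise_of_maps_to hmaps, ← sum_powerset_cyclesOf, Finset.mul_sum]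
  refine Finset.sum_le_sum fun T _ => ?_
  have hw : ∀ p ∈ P.filter (fun p => (cyclesOf p.1).image (Finset.map p.2) = T),
      cycleWeight p.1 = ∏ c ∈ T, (c.card - 1) := by
    intro p hp
    rw [← (mem_filter.1 hp).2, Finset.prod_image (Finset.map_injective p.2).injOn]
    simp [cycleWeight]
  rw [Finset.sum_congr rfl hw, Finset.sum_const, smul_eq_mul]
  refine Nat.mul_le_mul_right _ ?_
  have himg : ∀ p ∈ P.filter (fun p => (cyclesOf p.1).image (Finset.map p.2) = T),
      univ.map p.2 = T.biUnion id := by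
    intro p hp
    rw [← (mem_filter.1 hp).2]
    ext y
    simp only [Finset.mem_map, mem_univ, true_and, mem_biUnion, mem_image, id]
    constructor
    · rintro ⟨x, rfl⟩
      obtain ⟨c, hc, hx⟩ := mem_biUnion_cyclesOf_perm p.1 x
      exact ⟨_, ⟨c, hc, rfl⟩, mem_map_of_mem _ hx⟩
    · rintro ⟨_, ⟨c, -, rfl⟩, hy⟩
      obtain ⟨x, -, hx⟩ := Finset.mem_map.1 hy
      exact ⟨x, hx⟩
  rcases (P.filter (fun p => (cyclesOf p.1).image (Finset.map p.2) = T)).eq_empty_or_nonempty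
    with h0 | ⟨p₀, hp₀⟩
  · simp [h0]
  have hU : Fintype.card (Fin z ↪ (T.biUnion id)) = z.factorial := by
    rw [Fintype.card_embedding_eq, Fintype.card_coe, ← himg p₀ hp₀]
    simp [Nat.descFactorial_self]
  rw [← hU, ← Fintype.card_coe]
  refine Fintype.card_le_of_injective (fun p => ⟨fun i => ⟨p.1.2 i, ?_⟩, ?_⟩) ?_
  · rw [← himg p.1 p.2]
    exact mem_map_of_mem _ (mem_univ i)
  · intro i j hij
    exact p.1.2.injective (Subtype.ext_iff.1 hij)
  · rintro ⟨⟨σ, e⟩, hp⟩ ⟨⟨σ', e'⟩, hp'⟩ hpp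
    have he : e = e' := by
      ext i
      have := DFunLike.congr_fun hpp i
      exact congrArg Fin.val (Subtype.ext_iff.1 this)
    subst he
    have e1 := (hPm _).1 (mem_filter.1 hp).1
    have e2 := (hPm _).1 (mem_filter.1 hp').1
    have hσ : σ = σ' := by
      apply DFunLike.coe_injective
      exact e.injective.comp_left (e1.symm.trans e2)
    subst hσ
    rfl

theorem cycleWeight_eq_prod_cycleType {z : ℕ} {σ : Equiv.Perm (Fin z)} (hσ : σ.support = univ) :
    cycleWeight σ = (σ.cycleType.map fun p => p - 1).prod := by
  have himg : cyclesOf σ = σ.cycleFactorsFinset.image Equiv.Perm.support := by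
    have hc : ∀ x, (cyclicSet σ).filter (fun y => ∃ m, σ^[m] x = y) =
        (σ.cycleOf x).support := by
      intro x
      ext y
      rw [Equiv.Perm.mem_support_cycleOf_iff, hσ]
      simp only [mem_filter, mem_cyclicSet_perm, true_and, mem_univ, and_true,
        ← Equiv.Perm.coe_pow]
      constructor
      · rintro ⟨m, rfl⟩
        exact ⟨m, by simp⟩
      · intro h
        obtain ⟨i, -, -, hi⟩ := h.exists_pow_eq
        exact ⟨i, hi⟩
    ext c
    simp only [cyclesOf, mem_image, hc, mem_cyclicSet_perm, true_and]
    constructor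
    · rintro ⟨x, rfl⟩
      exact ⟨_, Equiv.Perm.cycleOf_mem_cycleFactorsFinset_iff.2 (by simp [hσ]), rfl⟩
    · rintro ⟨g, hg, rfl⟩
      obtain ⟨x, hx⟩ := (Equiv.Perm.mem_cycleFactorsFinset_iff.1 hg).1.nonempty_support
      exact ⟨x, by rw [Equiv.Perm.cycle_is_cycleOf hx hg]⟩
  rw [cycleWeight, himg, Finset.prod_image, Equiv.Perm.cycleType_def, Multiset.map_map]
  · rfl
  · intro g hg g' hg' h
    obtain ⟨x, hx⟩ := (Equiv.Perm.mem_cycleFactorsFinset_iff.1 hg).1.nonempty_support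
    rw [Equiv.Perm.cycle_is_cycleOf hx hg, Equiv.Perm.cycle_is_cycleOf (h ▸ hx) hg']

theorem prod_le_mul_prod_sub_one {z : ℕ} (hz : 1 ≤ z) :
    ∀ Q : Finset ℕ, Q ⊆ Icc 2 z → ∏ p ∈ Q, p ≤ z * ∏ p ∈ Q, (p - 1) := by
  induction z, hz using Nat.le_induction with
  | base =>
    intro Q hQ
    have : Q = ∅ := by simpa using hQ
    simp [this]
  | succ z hz ih =>
    intro Q hQ
    have herase : Q.erase (z + 1) ⊆ Icc 2 z := by
      intro p hp
      have h1 := mem_Icc.1 (hQ (mem_of_mem_erase hp))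
      have h2 := ne_of_mem_erase hp
      exact mem_Icc.2 ⟨h1.1, by omega⟩
    have h := ih _ herase
    by_cases hm : z + 1 ∈ Q
    · rw [← Finset.mul_prod_erase Q _ hm, ← Finset.mul_prod_erase Q (fun p => p - 1) hm]
      exact Nat.mul_le_mul_left _ h
    · rw [Finset.erase_eq_of_notMem hm] at h
      exact h.trans (Nat.mul_le_mul_right _ z.le_succ)

theorem factorial_le_mul_sum_cycleType {z : ℕ} (hz : 1 ≤ z) {Q : Finset ℕ} (hQ : Q ⊆ Icc 2 z)
    (hsum : ∑ p ∈ Q, p = z) :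
    z.factorial ≤ z * ∑ σ ∈ (univ : Finset (Equiv.Perm (Fin z))) with σ.cycleType = Q.val,
      cycleWeight σ := by
  have hs : Q.val.sum = z := by rw [← hsum, Finset.sum_eq_multiset_sum, Multiset.map_id']
  have hp : Q.val.prod = ∏ p ∈ Q, p := by rw [Finset.prod_eq_multiset_prod, Multiset.map_id']
  have hcount : ∏ n ∈ Q.val.toFinset, (Q.val.count n).factorial = 1 := by
    refine Finset.prod_eq_one fun n _ => ?_
    have := Multiset.nodup_iff_count_le_one.1 Q.nodup n
    exact Nat.factorial_eq_one.2 this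
  have hN := Equiv.Perm.card_of_cycleType_mul_eq (Fin z) Q.val
  rw [hcount, hs, hp, Fintype.card_fin, if_pos ⟨le_rfl, fun a ha => (mem_Icc.1 (hQ ha)).1⟩] at hN
  simp only [Nat.sub_self, Nat.factorial_zero, one_mul, mul_one] at hN
  have hw : ∀ σ ∈ (univ : Finset (Equiv.Perm (Fin z))).filter (fun σ => σ.cycleType = Q.val),
      cycleWeight σ = ∏ p ∈ Q, (p - 1) := by
    intro σ hσ
    have hσ' := (mem_filter.1 hσ).2
    have hsupp : σ.support = univ := by
      rw [← Finset.card_eq_iff_eq_univ, ← Equiv.Perm.sum_cycleType, hσ', hs, Fintype.card_fin]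
    rw [cycleWeight_eq_prod_cycleType hsupp, hσ']
    rfl
  rw [Finset.sum_congr rfl hw, Finset.sum_const, smul_eq_mul, ← hN, mul_left_comm]
  exact Nat.mul_le_mul_left _ (prod_le_mul_prod_sub_one hz Q hQ)

/-- Permutations with distinct cycle lengths already make the total weight large. -/
theorem factorial_mul_two_pow_le_sum_cycleWeight {M : ℕ} (hM : 1 ≤ M) :
    (2 * M ^ 2).factorial * 2 ^ (M - 1) ≤
      2 * M ^ 2 * ∑ σ : Equiv.Perm (Fin (2 * M ^ 2)), cycleWeight σ := by
  obtain ⟨z, hz⟩ : ∃ z, z = 2 * M ^ 2 := ⟨_, rfl⟩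
  rw [← hz]
  have hlast : ∀ S ∈ (Icc 2 M).powerset, ∑ p ∈ S, p + M + 1 ≤ z := by
    intro S hS
    have h1 : ∑ p ∈ S, p ≤ (M - 1) * M := by
      refine (Finset.sum_le_card_nsmul S _ M fun p hp =>
        (mem_Icc.1 (mem_powerset.1 hS hp)).2).trans ?_
      have := card_le_card (mem_powerset.1 hS)
      rw [Nat.card_Icc] at this
      exact Nat.mul_le_mul_right _ (by omega)
    obtain ⟨m, rfl⟩ : ∃ m, M = m + 1 := ⟨M - 1, by omega⟩
    simp only [Nat.add_sub_cancel] at h1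
    nlinarith
  set Q : Finset ℕ → Finset ℕ := fun S => insert (z - ∑ p ∈ S, p) S with hQ
  have hrec : ∀ S ∈ (Icc 2 M).powerset, (Q S).filter (· ≤ M) = S := by
    intro S hS
    have := hlast S hS
    rw [hQ, Finset.filter_insert, if_neg (by omega), Finset.filter_true_of_mem]
    exact fun p hp => (mem_Icc.1 (mem_powerset.1 hS hp)).2
  have hdisj : Set.PairwiseDisjoint ((Icc 2 M).powerset : Set (Finset ℕ)) fun S =>
      (univ : Finset (Equiv.Perm (Fin z))).filter (fun σ => σ.cycleType = (Q S).val) := by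
    intro S hS S' hS' hne
    rw [Function.onFun, Finset.disjoint_left]
    intro σ h1 h2
    have h3 : Q S = Q S' :=
      Finset.val_injective ((mem_filter.1 h1).2.symm.trans (mem_filter.1 h2).2)
    exact hne (by rw [← hrec S hS, ← hrec S' hS', h3])
  calc z.factorial * 2 ^ (M - 1) = ∑ S ∈ (Icc 2 M).powerset, z.factorial := by
        rw [Finset.sum_const, card_powerset, Nat.card_Icc, smul_eq_mul, mul_comm]
        rfl
    _ ≤ ∑ S ∈ (Icc 2 M).powerset, z * ∑ σ ∈ (univ : Finset (Equiv.Perm (Fin z))) with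
          σ.cycleType = (Q S).val, cycleWeight σ := by
        refine Finset.sum_le_sum fun S hS => ?_
        have h1 := hlast S hS
        refine factorial_le_mul_sum_cycleType (by omega) ?_ ?_
        · intro p hp
          rcases mem_insert.1 hp with rfl | hp
          · exact mem_Icc.2 ⟨by omega, by omega⟩
          · have := mem_Icc.1 (mem_powerset.1 hS hp)
            exact mem_Icc.2 ⟨this.1, by omega⟩
        · rw [hQ, Finset.sum_insert]
          · omega
          · intro hp
            have := (mem_Icc.1 (mem_powerset.1 hS hp)).2
            omega
    _ = z * ∑ σ ∈ (Icc 2 M).powerset.biUnion fun S =>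
          (univ : Finset (Equiv.Perm (Fin z))).filter (fun σ => σ.cycleType = (Q S).val),
          cycleWeight σ := by
        rw [Finset.sum_biUnion hdisj, Finset.mul_sum]
    _ ≤ z * ∑ σ : Equiv.Perm (Fin z), cycleWeight σ :=
        Nat.mul_le_mul_left _ (Finset.sum_le_sum_of_subset (subset_univ _))

/-- Lower bound for the total of `B` in terms of an auxiliary parameter `M`. -/
theorem zkMaps_card_mul_le_sum_Bmap {k r M : ℕ} (hk : 0 < k) (hM : 1 ≤ M) :
    (zkMaps (k * r) k).card * (k ^ (2 * M ^ 2) * r.descFactorial (2 * M ^ 2)) * 2 ^ (M - 1) ≤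
      2 * M ^ 2 * ((k * r).descFactorial (2 * M ^ 2) * ∑ f ∈ zkMaps (k * r) k, Bmap f) := by
  have hW := factorial_mul_two_pow_le_sum_cycleWeight hM
  obtain ⟨z, hz⟩ : ∃ z, z = 2 * M ^ 2 := ⟨_, rfl⟩
  rw [← hz] at hW ⊢
  set A := (zkMaps (k * r) k).card * (k ^ z * r.descFactorial z) with hA
  have h1 : A * ∑ σ : Equiv.Perm (Fin z), cycleWeight σ ≤
      (k * r).descFactorial z * (z.factorial * ∑ f ∈ zkMaps (k * r) k, Bmap f) := by
    calc A * ∑ σ : Equiv.Perm (Fin z), cycleWeight σ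
        = ∑ σ : Equiv.Perm (Fin z), (k * r).descFactorial z * ∑ f ∈ zkMaps (k * r) k,
            (univ.filter fun e : Fin z ↪ Fin (k * r) => f ∘ e = e ∘ σ).card * cycleWeight σ := by
          rw [Finset.mul_sum]
          refine Finset.sum_congr rfl fun σ _ => ?_
          rw [hA, ← sum_card_intertwining hk σ, ← Finset.sum_mul]
          ring
      _ = (k * r).descFactorial z * ∑ f ∈ zkMaps (k * r) k, ∑ σ : Equiv.Perm (Fin z),
            (univ.filter fun e : Fin z ↪ Fin (k * r) => f ∘ e = e ∘ σ).card * cycleWeight σ := by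
          rw [← Finset.mul_sum, Finset.sum_comm]
      _ ≤ _ := by
          rw [Finset.mul_sum (zkMaps (k * r) k) _ z.factorial]
          exact Nat.mul_le_mul_left _ (Finset.sum_le_sum fun f _ => sum_cycleWeight_le z f)
  refine Nat.le_of_mul_le_mul_left ?_ z.factorial_pos
  calc z.factorial * (A * 2 ^ (M - 1)) = A * (z.factorial * 2 ^ (M - 1)) := by ring
    _ ≤ A * (z * ∑ σ : Equiv.Perm (Fin z), cycleWeight σ) := Nat.mul_le_mul_left _ hW
    _ = z * (A * ∑ σ : Equiv.Perm (Fin z), cycleWeight σ) := by ring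
    _ ≤ z * ((k * r).descFactorial z * (z.factorial * ∑ f ∈ zkMaps (k * r) k, Bmap f)) :=
        Nat.mul_le_mul_left _ h1
    _ = _ := by ring

theorem descFactorial_mul_one_sub_pow_le {k r z : ℕ} (hr : 0 < r) (hz : z ≤ r) :
    ((k * r).descFactorial z : ℝ) * (1 - z / r) ^ z ≤ k ^ z * r.descFactorial z := by
  have hr' : (0 : ℝ) < r := by exact_mod_cast hr
  have hz' : (z : ℝ) ≤ r := by exact_mod_cast hz
  have h0 : (0 : ℝ) ≤ 1 - z / r := by
    rw [sub_nonneg, div_le_one hr']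
    exact hz'
  have h1 : ((k * r).descFactorial z : ℝ) ≤ ((k : ℝ) * r) ^ z := by
    exact_mod_cast Nat.descFactorial_le_pow (k * r) z
  have h2 : ((r : ℝ) - z) ^ z ≤ r.descFactorial z := by
    have h : (r - z) ^ z ≤ r.descFactorial z :=
      (Nat.pow_le_pow_left (by omega) z).trans (Nat.pow_sub_le_descFactorial r z)
    rw [← Nat.cast_sub hz]
    exact_mod_cast h
  calc ((k * r).descFactorial z : ℝ) * (1 - z / r) ^ z
      ≤ ((k : ℝ) * r) ^ z * (1 - z / r) ^ z := by gcongr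
    _ = k ^ z * ((r : ℝ) - z) ^ z := by
        rw [← mul_pow, ← mul_pow]
        congr 1
        field_simp
    _ ≤ k ^ z * r.descFactorial z := by gcongr

theorem exp_neg_two_mul_le_one_sub {x : ℝ} (h0 : 0 ≤ x) (h1 : x ≤ 1 / 2) :
    Real.exp (-(2 * x)) ≤ 1 - x := by
  rw [Real.exp_neg]
  refine inv_le_of_inv_le₀ (by linarith) ?_
  refine le_trans ?_ (Real.add_one_le_exp (2 * x))
  rw [inv_le_iff_one_le_mul₀ (by linarith)]
  nlinarith

theorem exp_mul_two_pow_le_zkExp {k r M : ℕ} (hk : 0 < k) (hM : 1 ≤ M) (hr : 4 * M ^ 2 ≤ r)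
    (hne : (zkMaps (k * r) k).Nonempty) :
    Real.exp (-(8 * M ^ 4 / r)) * 2 ^ (M - 1) / (2 * M ^ 2) ≤
      zkExp (k * r) k (fun g => (Bmap g : ℝ)) := by
  have key : ((zkMaps (k * r) k).card : ℝ) *
      (k ^ (2 * M ^ 2) * r.descFactorial (2 * M ^ 2)) * 2 ^ (M - 1) ≤
      2 * M ^ 2 * ((k * r).descFactorial (2 * M ^ 2) * ∑ f ∈ zkMaps (k * r) k, (Bmap f : ℝ)) := by
    exact_mod_cast zkMaps_card_mul_le_sum_Bmap (r := r) hk hM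
  have hM2 : 0 < M ^ 2 := by positivity
  have hr0 : 0 < r := by omega
  have hr' : (0 : ℝ) < r := by exact_mod_cast hr0
  have hM' : (0 : ℝ) < M := by exact_mod_cast hM
  have hrM : 4 * (M : ℝ) ^ 2 ≤ r := by exact_mod_cast hr
  have hdf := descFactorial_mul_one_sub_pow_le (k := k) hr0 (show 2 * M ^ 2 ≤ r by omega)
  have hexp : Real.exp (-(8 * M ^ 4 / r)) ≤
      (1 - ((2 * M ^ 2 : ℕ) : ℝ) / r) ^ (2 * M ^ 2) := by
    have h := exp_neg_two_mul_le_one_sub (x := ((2 * M ^ 2 : ℕ) : ℝ) / r) (by positivity) (by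
      rw [div_le_iff₀ hr']
      push_cast
      linarith)
    refine le_trans (le_of_eq ?_) (pow_le_pow_left₀ (Real.exp_pos _).le h _)
    rw [← Real.exp_nat_mul]
    congr 1
    push_cast
    field_simp
    ring
  have hD : (0 : ℝ) < (k * r).descFactorial (2 * M ^ 2) := by
    have hle : r ≤ k * r := Nat.le_mul_of_pos_left r hk
    exact_mod_cast Nat.descFactorial_pos.2 (by omega)
  have hcard : (0 : ℝ) < (zkMaps (k * r) k).card := by exact_mod_cast hne.card_pos
  rw [zkExp, div_le_div_iff₀ (by positivity) hcard]
  refine le_of_mul_le_mul_left ?_ hD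
  calc ((k * r).descFactorial (2 * M ^ 2) : ℝ) *
        (Real.exp (-(8 * M ^ 4 / r)) * 2 ^ (M - 1) * (zkMaps (k * r) k).card)
      = (zkMaps (k * r) k).card * ((k * r).descFactorial (2 * M ^ 2) *
          Real.exp (-(8 * M ^ 4 / r))) * 2 ^ (M - 1) := by ring
    _ ≤ (zkMaps (k * r) k).card *
          (k ^ (2 * M ^ 2) * r.descFactorial (2 * M ^ 2)) * 2 ^ (M - 1) := by
        have h := (mul_le_mul_of_nonneg_left hexp hD.le).trans hdf
        exact mul_le_mul_of_nonneg_right (mul_le_mul_of_nonneg_left h hcard.le) (by positivity)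
    _ ≤ _ := key
    _ = _ := by ring

theorem eventually_exp_half_le :
    ∀ᶠ M : ℕ in atTop,
      Real.exp (M / 2) ≤ Real.exp (-(M / 8)) * 2 ^ (M - 1) / (2 * M ^ 2) := by
  have h1 : Tendsto (fun M : ℕ => (M : ℝ) / 20) atTop atTop :=
    tendsto_natCast_atTop_atTop.atTop_div_const (by norm_num)
  filter_upwards [((Real.tendsto_exp_div_pow_atTop 2).comp h1).eventually_ge_atTop 1600,
    eventually_ge_atTop 1] with M hM hM1
  have hM0 : (0 : ℝ) < M := by exact_mod_cast hM1
  simp only [Function.comp_apply] at hM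
  rw [le_div_iff₀ (by positivity)] at hM ⊢
  have h2 : (2 : ℝ) ^ (M - 1) = 2 ^ M / 2 := by
    obtain ⟨m, rfl⟩ : ∃ m, M = m + 1 := ⟨M - 1, by omega⟩
    rw [Nat.add_sub_cancel, pow_succ]
    ring
  have h3 : Real.exp (M * (69 / 100)) ≤ (2 : ℝ) ^ M := by
    rw [Real.exp_nat_mul]
    refine pow_le_pow_left₀ (Real.exp_pos _).le ?_ _
    rw [← Real.le_log_iff_exp_le (by norm_num)]
    linarith [Real.log_two_gt_d9]
  have h4 : Real.exp (M / 2) * Real.exp (M / 20) ≤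
      Real.exp (-(M / 8)) * Real.exp (M * (69 / 100)) := by
    rw [← Real.exp_add, ← Real.exp_add]
    exact Real.exp_le_exp.2 (by linarith)
  have h5 : 4 * (M : ℝ) ^ 2 ≤ Real.exp (M / 20) := by
    calc 4 * (M : ℝ) ^ 2 = 1600 * (M / 20) ^ 2 := by ring
      _ ≤ _ := hM
  have h6 : Real.exp (M / 2) * (4 * (M : ℝ) ^ 2) ≤ Real.exp (-(M / 8)) * 2 ^ M :=
    (mul_le_mul_of_nonneg_left h5 (Real.exp_pos _).le).trans
      (h4.trans (mul_le_mul_of_nonneg_left h3 (Real.exp_pos _).le))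
  rw [h2]
  linarith

/-- The expected product of cycle lengths is at least `exp (c n ^ (1/3))`. -/
theorem eventually_exp_le_zkExp {k : ℕ} (hk : 0 < k) :
    ∀ᶠ r : ℕ in atTop, (zkMaps (k * r) k).Nonempty →
      Real.exp ((r : ℝ) ^ ((1 : ℝ) / 3) / 16) ≤ zkExp (k * r) k (fun g => (Bmap g : ℝ)) := by
  have hroot : Tendsto (fun r : ℕ => (r : ℝ) ^ ((1 : ℝ) / 3)) atTop atTop :=
    (tendsto_rpow_atTop (by norm_num)).comp tendsto_natCast_atTop_atTop
  have hfloor : Tendsto (fun r : ℕ => ⌊(r : ℝ) ^ ((1 : ℝ) / 3) / 4⌋₊) atTop atTop :=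
    tendsto_nat_floor_atTop.comp (hroot.atTop_div_const (by norm_num))
  filter_upwards [hfloor.eventually eventually_exp_half_le, hfloor.eventually_ge_atTop 1,
    hroot.eventually_ge_atTop 8, eventually_gt_atTop 0] with r h1 hM h8 hr hne
  set M := ⌊(r : ℝ) ^ ((1 : ℝ) / 3) / 4⌋₊
  set t := (r : ℝ) ^ ((1 : ℝ) / 3) with ht
  have hr' : (0 : ℝ) < r := by exact_mod_cast hr
  have ht3 : t ^ 3 = r := by
    rw [ht, ← Real.rpow_natCast, ← Real.rpow_mul hr'.le]
    norm_num
  have hMt : (M : ℝ) ≤ t / 4 := Nat.floor_le (by linarith)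
  have htM : t / 4 < M + 1 := Nat.lt_floor_add_one _
  have hM' : (1 : ℝ) ≤ M := by exact_mod_cast hM
  have hM3 : 64 * (M : ℝ) ^ 3 ≤ r := by
    have := pow_le_pow_left₀ (by linarith) hMt 3
    rw [← ht3]
    linarith [show (t / 4) ^ 3 = t ^ 3 / 64 by ring]
  have hM2 : 4 * M ^ 2 ≤ r := by
    have : 4 * (M : ℝ) ^ 2 ≤ r := by nlinarith [sq_nonneg (M : ℝ)]
    exact_mod_cast this
  refine le_trans ?_ (h1.trans (le_trans ?_ (exp_mul_two_pow_le_zkExp hk hM hM2 hne)))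
  · exact Real.exp_le_exp.2 (by linarith)
  · have : 8 * (M : ℝ) ^ 4 / r ≤ M / 8 := by
      rw [div_le_iff₀ hr']
      nlinarith
    gcongr

theorem Bmap_le_pow_Cmap {n : ℕ} (f : Fin n → Fin n) : Bmap f ≤ n ^ Cmap f := by
  refine Finset.prod_le_pow_card _ _ _ fun c _ => ?_
  simpa using card_le_univ c

theorem Bmap_pos {n : ℕ} (f : Fin n → Fin n) : 0 < Bmap f :=
  Finset.prod_pos fun _ hc => (nonempty_of_mem_cyclesOf hc).card_pos

/-- for large `r`, any `{0,k}`-mapping with fewer than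
`n^{1/3}/log³ n` cycles satisfies `B(f) < (E_n(B))^b`. -/
theorem stmt_18 (k : ℕ) (hk : 2 ≤ k) (b : ℕ → ℝ) (hb : ∀ r, 0 < b r)
    (hbo : Tendsto
      (fun r : ℕ => (b r)⁻¹ * (Real.log ((k * r : ℕ) : ℝ)) ^ (-(2 : ℝ)))
      atTop (nhds 0)) :
    ∀ᶠ r : ℕ in atTop, ∀ f : Fin (k * r) → Fin (k * r), IsZKMap k f →
      (Cmap f : ℝ) < ((k * r : ℕ) : ℝ) ^ ((1 : ℝ) / 3) /
        (Real.log ((k * r : ℕ) : ℝ)) ^ 3 →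
      (Bmap f : ℝ) < (zkExp (k * r) k (fun g => (Bmap g : ℝ))) ^ (b r) := by
  have hk0 : 0 < k := by omega
  have hk1 : (1 : ℝ) ≤ k := by exact_mod_cast hk0
  filter_upwards [eventually_exp_le_zkExp hk0, eventually_ge_atTop 2,
    hbo.eventually_lt_const (show (0 : ℝ) < 1 / (16 * k) by positivity)]
    with r hE hr hbr f hf hC
  replace hE := hE ⟨f, mem_filter.2 ⟨mem_univ _, hf⟩⟩
  have hn : 1 < k * r := by nlinarith
  have hL : 0 < Real.log ((k * r : ℕ) : ℝ) := Real.log_pos (by exact_mod_cast hn)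
  set L := Real.log ((k * r : ℕ) : ℝ) with hLdef
  set t := (r : ℝ) ^ ((1 : ℝ) / 3) with ht
  have hr' : (0 : ℝ) < r := by positivity
  have ht0 : 0 < t := Real.rpow_pos_of_pos hr' _
  have hnt : ((k * r : ℕ) : ℝ) ^ ((1 : ℝ) / 3) ≤ k * t := by
    rw [Nat.cast_mul, Real.mul_rpow (by positivity) hr'.le]
    refine mul_le_mul_of_nonneg_right ?_ ht0.le
    exact Real.rpow_le_self_of_one_le hk1 (by norm_num)
  have hb' : 16 * k < b r * L ^ 2 := by
    rw [Real.rpow_neg hL.le, Real.rpow_two, ← mul_inv, inv_lt_comm₀ (by have := hb r; positivity)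
      (by positivity)] at hbr
    simpa using hbr
  have hB : (0 : ℝ) < Bmap f := by exact_mod_cast Bmap_pos f
  have hlog : Real.log (Bmap f) ≤ Cmap f * L := by
    rw [hLdef, ← Real.log_pow]
    exact Real.log_le_log hB (by exact_mod_cast Bmap_le_pow_Cmap f)
  have hlt : Real.log (Bmap f) < t / 16 * b r := by
    calc Real.log (Bmap f) ≤ Cmap f * L := hlog
      _ < ((k * r : ℕ) : ℝ) ^ ((1 : ℝ) / 3) / L ^ 3 * L := by gcongr
      _ ≤ k * t / L ^ 3 * L := by gcongr
      _ = 16 * k * (t / 16) / L ^ 2 := by field_simp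
      _ < b r * L ^ 2 * (t / 16) / L ^ 2 := by gcongr
      _ = t / 16 * b r := by field_simp
  calc (Bmap f : ℝ) = Real.exp (Real.log (Bmap f)) := (Real.exp_log hB).symm
    _ < Real.exp (t / 16 * b r) := Real.exp_lt_exp.2 hlt
    _ = Real.exp (t / 16) ^ b r := Real.exp_mul _ _
    _ ≤ _ := Real.rpow_le_rpow (Real.exp_pos _).le hE (hb r).le
end
end
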